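/- Let n ≥ 5 and let u be a classical Schwartz solution of the energy-critical Hartree equation on a compact time interval I of positive length |I|. Let A ≥ 1 and let E₀ ≥ 0 be such that E(u(t,·)) ≤ E₀ for all t ∈ I. Then there is a constant C depending only on n such that ∫_I ∫_{‖x‖ ≤ A|I|^{1/2}} |u(t,x)|²/‖x‖³ dx dt − ∫_I ∫∫_Ω ⟪x/‖x‖ − y/‖y‖, ∇V(x−y)⟫ |u(t,x)|² |u(t,y)|² dy dx dt ≤ C · A · |I|^{1/2} · E₀, where Ω = {(x,y) ∈ ℝⁿ×ℝⁿ : ‖x‖ ≤ A|I|^{1/2} and ‖y‖ ≤ A|I|^{1/2}} and ∇V(z) = −4‖z‖^{−6} z is the gradient of V(z) = ‖z‖^{−4}. -/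

import Mathlib

open MeasureTheory Set
open scoped RealInnerProductSpace ENNReal NNReal

noncomputable section

abbrev En (n : ℕ) := EuclideanSpace ℝ (Fin n)

/-- Spatial Laplacian of a complex-valued function. -/
def lapC {n : ℕ} (f : En n → ℂ) (x : En n) : ℂ :=
  ∑ j : Fin n, iteratedFDeriv ℝ 2 f x ![EuclideanSpace.single j 1, EuclideanSpace.single j 1]

/-- The Hartree nonlinearity potential `(V * |f|²)(x)` with `V z = ‖z‖⁻⁴`. -/
def hartreePotential {n : ℕ} (f : En n → ℂ) (x : En n) : ℝ :=
  ∫ y, (‖x - y‖ ^ 4)⁻¹ * ‖f y‖ ^ 2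

/-- A classical Schwartz solution of the energy-critical Hartree equation on `I`. -/
structure IsHartreeSolution (n : ℕ) (I : Set ℝ) (u : ℝ → En n → ℂ) : Prop where
  smooth : ContDiffOn ℝ (⊤ : ℕ∞) (fun p : ℝ × En n => u p.1 p.2) (I ×ˢ Set.univ)
  schwartz : ∀ t ∈ I, ∃ φ : SchwartzMap (En n) ℂ, ⇑φ = u t
  eqn : ∀ t ∈ I, ∀ x, Complex.I * deriv (fun s => u s x) t + lapC (u t) x
      = (hartreePotential (u t) x : ℂ) * u t x

/-- The energy of `φ`. -/
def energy (n : ℕ) (φ : En n → ℂ) : ℝ :=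
  (1/2) * (∫ x, ∑ j : Fin n, ‖fderiv ℝ φ x (EuclideanSpace.single j 1)‖ ^ 2)
  + (1/4) * ∫ x, ∫ y, (‖x - y‖ ^ 4)⁻¹ * ‖φ x‖ ^ 2 * ‖φ y‖ ^ 2


/-! ### Directional derivatives -/

/-- Directional derivative of a real function. -/
def pd {E : Type*} [NormedAddCommGroup E] [NormedSpace ℝ E] (e : E) (f : E → ℝ) : E → ℝ :=
  fun x => fderiv ℝ f x e

/-- Smooth real functions. -/
abbrev Sm {E : Type*} [NormedAddCommGroup E] [NormedSpace ℝ E] (f : E → ℝ) : Prop :=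
  ContDiff ℝ (⊤ : ℕ∞) f

lemma two_le_smooth : minSmoothness ℝ 2 ≤ ((⊤ : ℕ∞) : WithTop ℕ∞) := by
  simp only [minSmoothness_of_isRCLikeNormedField]
  exact WithTop.coe_le_coe.2 (le_top : (2 : ℕ∞) ≤ ⊤)

section pdBasics
variable {E : Type*} [NormedAddCommGroup E] [NormedSpace ℝ E]

lemma Sm.diff {f : E → ℝ} (hf : Sm f) : Differentiable ℝ f :=
  hf.differentiable (by simp)

lemma Sm.pd {f : E → ℝ} (hf : Sm f) (e : E) : Sm (pd e f) := by
  have : ContDiff ℝ (⊤ : ℕ∞) (fderiv ℝ f) := hf.fderiv_right (by simp)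
  exact this.clm_apply contDiff_const

lemma Sm.mul {f g : E → ℝ} (hf : Sm f) (hg : Sm g) : Sm (fun x => f x * g x) := ContDiff.mul hf hg
lemma Sm.add {f g : E → ℝ} (hf : Sm f) (hg : Sm g) : Sm (fun x => f x + g x) := ContDiff.add hf hg
lemma Sm.sub {f g : E → ℝ} (hf : Sm f) (hg : Sm g) : Sm (fun x => f x - g x) := ContDiff.sub hf hg
lemma Sm.cmul {f : E → ℝ} (c : ℝ) (hf : Sm f) : Sm (fun x => c * f x) :=
  ContDiff.mul contDiff_const hf
lemma Sm.at {f : E → ℝ} (hf : Sm f) (x : E) : DifferentiableAt ℝ f x := hf.diff x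
lemma Sm.cont {f : E → ℝ} (hf : Sm f) : Continuous f := hf.continuous

lemma pd_add {f g : E → ℝ} {x : E} (hf : DifferentiableAt ℝ f x) (hg : DifferentiableAt ℝ g x) (e : E) :
    pd e (fun x => f x + g x) x = pd e f x + pd e g x := by
  simp only [pd]
  rw [fderiv_fun_add hf hg]; rfl

lemma pd_sub {f g : E → ℝ} {x : E} (hf : DifferentiableAt ℝ f x) (hg : DifferentiableAt ℝ g x) (e : E) :
    pd e (fun x => f x - g x) x = pd e f x - pd e g x := by
  simp only [pd]
  rw [fderiv_fun_sub hf hg]; rfl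

lemma pd_mul {f g : E → ℝ} {x : E} (hf : DifferentiableAt ℝ f x) (hg : DifferentiableAt ℝ g x) (e : E) :
    pd e (fun x => f x * g x) x = pd e f x * g x + f x * pd e g x := by
  simp only [pd]
  rw [fderiv_fun_mul hf hg]
  simp; ring

lemma pd_const_mul {f : E → ℝ} {x : E} (c : ℝ) (hf : DifferentiableAt ℝ f x) (e : E) :
    pd e (fun x => c * f x) x = c * pd e f x := by
  simp only [pd]
  rw [fderiv_const_mul hf]; rfl

lemma pd_const (c : ℝ) (x : E) (e : E) :
    pd e (fun _ => c) x = 0 := by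
  simp [pd]

lemma pd_sum {ι : Type*} (s : Finset ι) {f : ι → E → ℝ} {x : E}
    (hf : ∀ i ∈ s, DifferentiableAt ℝ (f i) x) (e : E) :
    pd e (fun x => ∑ i ∈ s, f i x) x = ∑ i ∈ s, pd e (f i) x := by
  simp only [pd]
  rw [fderiv_fun_sum hf]
  simp

lemma pd_pow {f : E → ℝ} {x : E} (hf : DifferentiableAt ℝ f x) (m : ℕ) (e : E) :
    pd e (fun x => f x ^ (m+1)) x = (m+1) * f x ^ m * pd e f x := by
  simp only [pd]
  rw [fderiv_fun_pow (m+1) hf]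
  simp

lemma pd_comm {f : E → ℝ} (hf : Sm f) (e e' : E) : pd e (pd e' f) = pd e' (pd e f) := by
  funext x
  have h := (hf.contDiffAt (x := x)).isSymmSndFDerivAt (n := (⊤ : ℕ∞)) two_le_smooth
  have hd : DifferentiableAt ℝ (fderiv ℝ f) x :=
    ((hf.fderiv_right (m := (⊤ : ℕ∞)) (by simp)).differentiable (by simp)) x
  have key : ∀ a b : E, pd a (pd b f) x = fderiv ℝ (fderiv ℝ f) x a b := by
    intro a b
    have : fderiv ℝ (fun y => fderiv ℝ f y b) x = (fderiv ℝ (fderiv ℝ f) x).flip b := by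
      rw [fderiv_clm_apply hd (by fun_prop)]
      simp
    show fderiv ℝ (fun y => fderiv ℝ f y b) x a = _
    rw [this]; rfl
  rw [key, key]
  exact h e e'

lemma pd_eq_of_eventuallyEq {f g : E → ℝ} {x : E} (h : f =ᶠ[nhds x] g) (e : E) :
    pd e f x = pd e g x := by
  simp only [pd]; rw [h.fderiv_eq]

lemma pd_eqOn {f g : E → ℝ} {U : Set E} (hU : IsOpen U) (h : EqOn f g U) (e : E) :
    EqOn (pd e f) (pd e g) U := fun _ hx =>
  pd_eq_of_eventuallyEq (Filter.eventuallyEq_of_mem (hU.mem_nhds hx) h) e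

lemma HasCompactSupport.pd {f : E → ℝ} (hf : HasCompactSupport f) (e : E) :
    HasCompactSupport (pd e f) := by
  have := hf.fderiv ℝ
  exact this.comp_left (g := fun L : E →L[ℝ] ℝ => L e) (by simp)

lemma pd_comp_smul {f : E → ℝ} (hf : Differentiable ℝ f) (c : ℝ) (e : E) :
    pd e (fun x => f (c • x)) = fun x => c * pd e f (c • x) := by
  funext x
  have h1 : HasFDerivAt (fun x : E => c • x) (c • ContinuousLinearMap.id ℝ E) x :=
    (hasFDerivAt_id x).const_smul c
  have h2 := ((hf (c • x)).hasFDerivAt).comp x h1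
  have h3 : fderiv ℝ (fun x => f (c • x)) x = _ := h2.fderiv
  simp only [_root_.pd]
  rw [h3]; simp

end pdBasics

/-- Coordinate vector. -/
abbrev eb {n : ℕ} (j : Fin n) : En n := EuclideanSpace.single j 1

section IBP
variable {n : ℕ}

lemma integral_pd_zero {f : En n → ℝ} (e : En n) (hf : Differentiable ℝ f) (hi : Integrable f)
    (hi' : Integrable (pd e f)) : ∫ x, pd e f x = 0 := by
  have := integral_mul_fderiv_eq_neg_fderiv_mul_of_integrable (μ := (volume : Measure (En n)))
    (f := fun _ : En n => (1:ℝ)) (g := f) (v := e) (by simp) (by simpa using! hi') (by simpa using hi)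
    (fun x _ => by fun_prop) (fun x _ => hf x)
  simpa [pd] using this

lemma integral_pd_zero_cs {f : En n → ℝ} (e : En n) (hf : Sm f) (hc : HasCompactSupport f) :
    ∫ x, pd e f x = 0 :=
  integral_pd_zero e hf.diff (hf.continuous.integrable_of_hasCompactSupport hc)
    ((hf.pd e).continuous.integrable_of_hasCompactSupport (hc.pd e))

/-- Linear Morawetz identity. -/
lemma linear_morawetz_jk {f a : En n → ℝ} (hf : Sm f) (ha : Sm a) (hc : HasCompactSupport a) (j k : Fin n) :
    ∫ x, (-4 * (pd (eb j) (pd (eb j) f) x * (pd (eb k) a x * pd (eb k) f x))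
      - 2 * (pd (eb j) (pd (eb j) f) x * (pd (eb k) (pd (eb k) a) x * f x)))
    = ∫ x, (4 * (pd (eb j) (pd (eb k) a) x * (pd (eb j) f x * pd (eb k) f x))
      - pd (eb j) (pd (eb j) (pd (eb k) (pd (eb k) a))) x * f x ^ 2) := by
  set fj := pd (eb j) f with hfj
  set fk := pd (eb k) f with hfk
  set ak := pd (eb k) a with hak
  set akk := pd (eb k) ak with hakk
  set akkj := pd (eb j) akk with hakkj
  have sfj : Sm fj := hf.pd _
  have sfk : Sm fk := hf.pd _
  have sak : Sm ak := ha.pd _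
  have sakk : Sm akk := sak.pd _
  have sakkj : Sm akkj := sakk.pd _
  have cak : HasCompactSupport ak := hc.pd _
  have cakk : HasCompactSupport akk := cak.pd _
  have cakkj : HasCompactSupport akkj := cakk.pd _
  let P : En n → ℝ := fun x => ak x * (fj x * fk x)
  let Q : En n → ℝ := fun x => akk x * (fj x * f x)
  let S : En n → ℝ := fun x => akkj x * (f x * f x)
  let T : En n → ℝ := fun x => ak x * (fj x * fj x)
  have sP : Sm P := sak.mul (sfj.mul sfk)
  have sQ : Sm Q := sakk.mul (sfj.mul hf)
  have sS : Sm S := sakkj.mul (hf.mul hf)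
  have sT : Sm T := sak.mul (sfj.mul sfj)
  have cP : HasCompactSupport P := cak.mul_right
  have cQ : HasCompactSupport Q := cakk.mul_right
  have cS : HasCompactSupport S := cakkj.mul_right
  have cT : HasCompactSupport T := cak.mul_right
  have iP := (sP.pd (eb j)).continuous.integrable_of_hasCompactSupport (μ := volume) (cP.pd (eb j))
  have iQ := (sQ.pd (eb j)).continuous.integrable_of_hasCompactSupport (μ := volume) (cQ.pd (eb j))
  have iS := (sS.pd (eb j)).continuous.integrable_of_hasCompactSupport (μ := volume) (cS.pd (eb j))
  have iT := (sT.pd (eb k)).continuous.integrable_of_hasCompactSupport (μ := volume) (cT.pd (eb k))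
  have zP := integral_pd_zero_cs (eb j) sP cP
  have zQ := integral_pd_zero_cs (eb j) sQ cQ
  have zS := integral_pd_zero_cs (eb j) sS cS
  have zT := integral_pd_zero_cs (eb k) sT cT
  have tot : ∫ x, (-4 * pd (eb j) P x - 2 * pd (eb j) Q x + pd (eb j) S x + 2 * pd (eb k) T x) = 0 := by
    rw [integral_add, integral_add, integral_sub, integral_const_mul, integral_const_mul,
      integral_const_mul, zP, zQ, zS, zT]
    · simp
    · exact iP.const_mul _
    · exact iQ.const_mul _
    · exact (iP.const_mul _).sub (iQ.const_mul _)
    · exact iS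
    · exact ((iP.const_mul _).sub (iQ.const_mul _)).add iS
    · exact iT.const_mul _
  have hcomm : pd (eb k) fj = pd (eb j) fk := pd_comm hf _ _
  rw [← sub_eq_zero, ← integral_sub]
  · rw [← tot]
    congr 1
    funext x
    simp only [P, Q, S, T]
    rw [pd_mul sak.diff.differentiableAt (sfj.mul sfk).diff.differentiableAt,
      pd_mul sfj.diff.differentiableAt sfk.diff.differentiableAt,
      pd_mul sakk.diff.differentiableAt (sfj.mul hf).diff.differentiableAt,
      pd_mul sfj.diff.differentiableAt hf.diff.differentiableAt,
      pd_mul sakkj.diff.differentiableAt (hf.mul hf).diff.differentiableAt,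
      pd_mul hf.diff.differentiableAt hf.diff.differentiableAt,
      pd_mul sak.diff.differentiableAt (sfj.mul sfj).diff.differentiableAt,
      pd_mul sfj.diff.differentiableAt sfj.diff.differentiableAt, hcomm, ← hfj, ← hakk, ← hakkj]
    ring
  · apply Continuous.integrable_of_hasCompactSupport
    · have := (sfj.pd (eb j)).continuous
      have := sak.continuous; have := sakk.continuous; have := sfk.continuous
      have := hf.continuous
      fun_prop
    · apply HasCompactSupport.sub
      · exact ((cak.mul_right).mul_left).mul_left
      · exact ((cakk.mul_right).mul_left).mul_left
  · apply Continuous.integrable_of_hasCompactSupport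
    · have := (sak.pd (eb j)).continuous; have := (sakkj.pd (eb j)).continuous
      have := sfj.continuous; have := sfk.continuous
      have := hf.continuous
      fun_prop
    · apply HasCompactSupport.sub
      · exact ((cak.pd _).mul_right).mul_left
      · exact (cakkj.pd _).mul_right

end IBP


section weight
variable {n : ℕ}

/-- Regularised inverse norm. -/
def pw (s : ℝ) (x : En n) : ℝ := (Real.sqrt (‖x‖ ^ 2 + s))⁻¹

/-- Regularised norm. -/
def qw (s : ℝ) (x : En n) : ℝ := Real.sqrt (‖x‖ ^ 2 + s)

lemma sm_normsq : Sm (fun x : En n => ‖x‖ ^ 2) := contDiff_norm_sq ℝ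

lemma sm_coord (k : Fin n) : Sm (fun x : En n => x k) := by
  have : Sm (fun x : En n => EuclideanSpace.proj (𝕜 := ℝ) k x) := ContinuousLinearMap.contDiff _
  exact this

lemma pd_coord (j k : Fin n) (x : En n) :
    pd (eb j) (fun x : En n => x k) x = if k = j then 1 else 0 := by
  have : fderiv ℝ (fun x : En n => EuclideanSpace.proj (𝕜 := ℝ) k x) x
      = EuclideanSpace.proj (𝕜 := ℝ) k := ContinuousLinearMap.fderiv _
  show fderiv ℝ (fun x : En n => EuclideanSpace.proj (𝕜 := ℝ) k x) x (eb j) = _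
  rw [this]
  simp [Pi.single_apply]

lemma pd_normsq (j : Fin n) (x : En n) :
    pd (eb j) (fun x : En n => ‖x‖ ^ 2) x = 2 * x j := by
  simp only [pd]
  rw [(hasStrictFDerivAt_norm_sq x).hasFDerivAt.fderiv]
  simp [EuclideanSpace.inner_single_right]

lemma base_pos {s : ℝ} (hs : 0 < s) (x : En n) : 0 < ‖x‖ ^ 2 + s := by positivity

lemma sm_qw {s : ℝ} (hs : 0 < s) : Sm (qw (n := n) s) := by
  unfold qw
  exact ContDiff.sqrt (sm_normsq.add contDiff_const) (fun x => (base_pos hs x).ne')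

lemma qw_pos {s : ℝ} (hs : 0 < s) (x : En n) : 0 < qw s x := Real.sqrt_pos.2 (base_pos hs x)

lemma pw_pos {s : ℝ} (hs : 0 < s) (x : En n) : 0 < pw s x := inv_pos.2 (qw_pos hs x)

lemma sm_pw {s : ℝ} (hs : 0 < s) : Sm (pw (n := n) s) :=
  ContDiff.inv (sm_qw hs) (fun x => (qw_pos hs x).ne')

lemma pw_sq {s : ℝ} (hs : 0 < s) (x : En n) : (‖x‖ ^ 2 + s) * pw s x ^ 2 = 1 := by
  unfold pw
  rw [inv_pow, Real.sq_sqrt (base_pos hs x).le, mul_inv_cancel₀ (base_pos hs x).ne']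

lemma pd_qw {s : ℝ} (hs : 0 < s) (j : Fin n) (x : En n) :
    pd (eb j) (qw s) x = x j * pw s x := by
  have h1 : DifferentiableAt ℝ (fun x : En n => ‖x‖ ^ 2 + s) x :=
    (sm_normsq.add contDiff_const).at x
  have h2 : pd (eb j) (fun x : En n => ‖x‖ ^ 2 + s) x = 2 * x j := by
    rw [pd_add (sm_normsq.at x) (by fun_prop), pd_normsq, pd_const, add_zero]
  have h3 := h1.hasFDerivAt.sqrt (base_pos hs x).ne'
  have h4 : fderiv ℝ (qw s) x = _ := h3.fderiv
  simp only [pd] at h2 ⊢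
  rw [h4]
  simp only [smul_apply, h2, pw, smul_eq_mul]
  field_simp

lemma pd_pw {s : ℝ} (hs : 0 < s) (j : Fin n) (x : En n) :
    pd (eb j) (pw s) x = - (x j * pw s x ^ 3) := by
  have h3 := ((sm_qw hs).at x).hasFDerivAt
  have h4 : fderiv ℝ (pw s) x = _ := ((hasDerivAt_inv (qw_pos hs x).ne').comp_hasFDerivAt x h3).fderiv
  have h2 := pd_qw hs j x
  simp only [pd] at h2 ⊢
  rw [h4]
  simp only [smul_apply, h2, smul_eq_mul]
  have : pw s x = (qw s x)⁻¹ := rfl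
  rw [this]
  ring

lemma pd_pd_qw {s : ℝ} (hs : 0 < s) (j k : Fin n) (x : En n) :
    pd (eb j) (pd (eb k) (qw s)) x = (if k = j then 1 else 0) * pw s x - x j * x k * pw s x ^ 3 := by
  have : pd (eb k) (qw s) = fun x : En n => x k * pw s x := funext (pd_qw hs k)
  rw [this, pd_mul ((sm_coord k).at x) ((sm_pw hs).at x), pd_coord, pd_pw hs]
  ring

lemma hess_qw_nonneg {s : ℝ} (hs : 0 < s) (x : En n) (ξ : Fin n → ℝ) :
    0 ≤ ∑ j, ∑ k, pd (eb j) (pd (eb k) (qw s)) x * (ξ j * ξ k) := by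
  have h1 : ∑ j, ∑ k, pd (eb j) (pd (eb k) (qw s)) x * (ξ j * ξ k)
      = pw s x * ∑ j, ξ j ^ 2 - pw s x ^ 3 * (∑ j, x j * ξ j) ^ 2 := by
    simp only [pd_pd_qw hs, sub_mul, Finset.sum_sub_distrib]
    congr 1
    · simp only [ite_mul, one_mul, zero_mul, Finset.sum_ite_eq', Finset.mem_univ, if_true]
      simp [Finset.mul_sum, sq]
    · rw [sq, Finset.sum_mul_sum, Finset.mul_sum]
      refine Finset.sum_congr rfl fun j _ => ?_
      rw [Finset.mul_sum]
      refine Finset.sum_congr rfl fun k _ => ?_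
      ring
  rw [h1]
  have h2 := Finset.sum_mul_sq_le_sq_mul_sq Finset.univ (fun j => x j) ξ
  have h3 : ∑ j, x j ^ 2 = ‖x‖ ^ 2 := by
    rw [EuclideanSpace.norm_sq_eq]; simp
  rw [h3] at h2
  have h4 := pw_sq hs x
  have hp := pw_pos hs x
  have hX : 0 ≤ ∑ j, ξ j ^ 2 := Finset.sum_nonneg fun j _ => sq_nonneg _
  set X := ∑ j, ξ j ^ 2
  have h5 : pw s x * X = pw s x ^ 3 * ((‖x‖ ^ 2 + s) * X) := by
    calc pw s x * X = pw s x * X * ((‖x‖ ^ 2 + s) * pw s x ^ 2) := by rw [h4, mul_one]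
      _ = _ := by ring
  rw [h5, ← mul_sub]
  apply mul_nonneg (by positivity)
  nlinarith

lemma sum_coord_sq (x : En n) : ∑ j, x j ^ 2 = ‖x‖ ^ 2 := by
  rw [EuclideanSpace.norm_sq_eq]; simp

lemma lap_qw {s : ℝ} (hs : 0 < s) (x : En n) :
    ∑ k, pd (eb k) (pd (eb k) (qw s)) x = ((n:ℝ) - 1) * pw s x + s * pw s x ^ 3 := by
  simp only [pd_pd_qw hs, if_true, Finset.sum_sub_distrib, ← sq, ← Finset.sum_mul, sum_coord_sq]
  simp
  have h4 := pw_sq hs x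
  linear_combination -(pw s x) * h4

lemma pd_pd_pw {s : ℝ} (hs : 0 < s) (j : Fin n) (x : En n) :
    pd (eb j) (pd (eb j) (pw s)) x = - pw s x ^ 3 + 3 * x j ^ 2 * pw s x ^ 5 := by
  have : pd (eb j) (pw s) = fun x : En n => (-1) * (x j * pw s x ^ 3) := by
    funext x; rw [pd_pw hs]; ring
  have hs3 : Sm (fun x : En n => pw s x ^ 3) := (sm_pw hs).pow 3
  rw [this, pd_const_mul _ (((sm_coord j).mul hs3).at x), pd_mul ((sm_coord j).at x) (hs3.at x),
    pd_coord, pd_pow ((sm_pw hs).at x), pd_pw hs]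
  simp; ring

lemma pd_pd_pw3 {s : ℝ} (hs : 0 < s) (j : Fin n) (x : En n) :
    pd (eb j) (pd (eb j) (fun x => pw s x ^ 3)) x = - 3 * pw s x ^ 5 + 15 * x j ^ 2 * pw s x ^ 7 := by
  have : pd (eb j) (fun x => pw s x ^ 3) = fun x : En n => (-3) * (x j * pw s x ^ 5) := by
    funext x; rw [pd_pow ((sm_pw hs).at x), pd_pw hs]; push_cast; ring
  have hs3 : Sm (fun x : En n => pw s x ^ 5) := (sm_pw hs).pow 5
  rw [this, pd_const_mul _ (((sm_coord j).mul hs3).at x), pd_mul ((sm_coord j).at x) (hs3.at x),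
    pd_coord, pd_pow ((sm_pw hs).at x), pd_pw hs]
  simp; ring

lemma bilap_qw {s : ℝ} (hs : 0 < s) (hn : 5 ≤ n) (x : En n) :
    ∑ j, ∑ k, pd (eb j) (pd (eb j) (pd (eb k) (pd (eb k) (qw s)))) x ≤ - (8 * pw s x ^ 3) := by
  have sq1 : ∀ k : Fin n, Sm (pd (eb k) (pd (eb k) (qw (n := n) s))) := fun k =>
    ((sm_qw hs).pd _).pd _
  have h1 : ∀ j : Fin n, ∑ k, pd (eb j) (pd (eb j) (pd (eb k) (pd (eb k) (qw s)))) x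
      = ((n:ℝ) - 1) * (- pw s x ^ 3 + 3 * x j ^ 2 * pw s x ^ 5)
        + s * (- 3 * pw s x ^ 5 + 15 * x j ^ 2 * pw s x ^ 7) := by
    intro j
    have e1 : (fun x : En n => ∑ k, pd (eb k) (pd (eb k) (qw s)) x)
      = fun x => ((n:ℝ) - 1) * pw s x + s * pw s x ^ 3 := funext (lap_qw hs)
    have e2 : pd (eb j) (fun x : En n => ∑ k, pd (eb k) (pd (eb k) (qw s)) x)
      = fun x => ∑ k, pd (eb j) (pd (eb k) (pd (eb k) (qw s))) x := by
      funext x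
      rw [pd_sum _ (fun k _ => (sq1 k).at x)]
    have e3 : pd (eb j) (pd (eb j) (fun x : En n => ∑ k, pd (eb k) (pd (eb k) (qw s)) x)) x
      = ∑ k, pd (eb j) (pd (eb j) (pd (eb k) (pd (eb k) (qw s)))) x := by
      rw [e2, pd_sum _ (fun k _ => ((sq1 k).pd _).at x)]
    have hs3 : Sm (fun x : En n => pw s x ^ 3) := (sm_pw hs).pow 3
    rw [← e3, e1]
    have e4 : pd (eb j) (fun x => ((n:ℝ) - 1) * pw s x + s * pw s x ^ 3)
      = fun x : En n => ((n:ℝ) - 1) * pd (eb j) (pw s) x + s * pd (eb j) (fun x => pw s x ^ 3) x := by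
      funext x
      rw [pd_add (((sm_pw hs).cmul _).at x) ((hs3.cmul _).at x), pd_const_mul _ ((sm_pw hs).at x),
        pd_const_mul _ (hs3.at x)]
    rw [e4, pd_add ((((sm_pw hs).pd _).cmul _).at x) (((hs3.pd _).cmul _).at x),
      pd_const_mul _ (((sm_pw hs).pd _).at x), pd_const_mul _ ((hs3.pd _).at x),
      pd_pd_pw hs, pd_pd_pw3 hs]
  simp only [h1, Finset.sum_add_distrib, ← Finset.mul_sum, ← Finset.sum_mul, sum_coord_sq]
  simp
  have h4 := pw_sq hs x
  have hp := pw_pos hs x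
  set p := pw s x
  have hn' : (5:ℝ) ≤ n := by exact_mod_cast hn
  have e5 : ‖x‖ ^ 2 * p ^ 5 = p ^ 3 - s * p ^ 5 := by linear_combination p ^ 3 * h4
  have e7 : ‖x‖ ^ 2 * p ^ 7 = p ^ 5 - s * p ^ 7 := by linear_combination p ^ 5 * h4
  have : ((n:ℝ) - 1) * (-(n * p ^ 3) + 3 * ‖x‖ ^ 2 * p ^ 5) + s * (-(3 * (n * p ^ 5)) + 15 * ‖x‖ ^ 2 * p ^ 7)
    = - (((n:ℝ)-1)*(n-3)) * p ^ 3 - (6 * n - 18) * s * p ^ 5 - 15 * s ^ 2 * p ^ 7 := by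
    linear_combination 3 * ((n:ℝ) - 1) * e5 + 15 * s * e7
  rw [this]
  have a1 : 0 < p ^ 3 := by positivity
  have a2 : 0 ≤ (6 * (n:ℝ) - 18) * s * p ^ 5 := by
    apply mul_nonneg (mul_nonneg _ hs.le) (by positivity); linarith
  have a3 : 0 ≤ 15 * s ^ 2 * p ^ 7 := by positivity
  nlinarith [mul_nonneg (mul_nonneg (by linarith : (0:ℝ) ≤ n - 5) (by linarith : (0:ℝ) ≤ n + 1)) a1.le]

end weight


section weight2
variable {n : ℕ}

/-- Smooth truncated square root. -/
def etaw (r : ℝ) : ℝ := Real.sqrt r * Real.smoothTransition (4 * r - 1)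

lemma sm_etaw : Sm etaw := by
  rw [Sm, contDiff_iff_contDiffAt]
  intro r
  rcases lt_or_ge r (1/4) with h | h
  · have : etaw =ᶠ[nhds r] fun _ => 0 := by
      filter_upwards [gt_mem_nhds h] with y hy
      simp only [etaw]
      rw [Real.smoothTransition.zero_of_nonpos (by linarith), mul_zero]
    exact contDiffAt_const.congr_of_eventuallyEq this
  · have h0 : r ≠ 0 := by linarith
    have h1 : ContDiffAt ℝ (⊤ : ℕ∞) Real.sqrt r := Real.contDiffAt_sqrt h0
    refine h1.mul ?_
    have : ContDiff ℝ (⊤ : ℕ∞) (fun r : ℝ => Real.smoothTransition (4 * r - 1)) :=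
      Real.smoothTransition.contDiff.comp (by fun_prop)
    exact this.contDiffAt

lemma etaw_eq {r : ℝ} (h : 1/2 ≤ r) : etaw r = Real.sqrt r := by
  simp only [etaw]
  rw [Real.smoothTransition.one_of_one_le (by linarith), mul_one]

/-- Cutoff. -/
def chiw (n : ℕ) : ContDiffBump (0 : En n) := ⟨2, 3, by norm_num, by norm_num⟩

/-- Basic weight. -/
def bw (s : ℝ) (x : En n) : ℝ := qw s x * chiw n x

/-- Joint version of the weight. -/
def Bw (z : ℝ × En n) : ℝ := etaw (‖z.2‖ ^ 2 + z.1) * chiw n z.2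

lemma sm_Bw : Sm (Bw (n := n)) := by
  refine Sm.mul ?_ ?_
  · refine sm_etaw.comp ?_
    exact (sm_normsq.comp contDiff_snd).add contDiff_fst
  · exact (ContDiffBump.contDiff (chiw n)).comp contDiff_snd

lemma sm_bw {s : ℝ} (hs : 0 < s) : Sm (bw (n := n) s) :=
  Sm.mul (sm_qw hs) (ContDiffBump.contDiff (chiw n))

lemma cs_bw {s : ℝ} : HasCompactSupport (bw (n := n) s) :=
  (ContDiffBump.hasCompactSupport (chiw n)).mul_left

lemma bw_in (s : ℝ) : EqOn (bw (n := n) s) (qw s) {x | ‖x‖ < 2} := by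
  intro x hx
  simp only [bw]
  rw [(chiw n).one_of_mem_closedBall, mul_one]
  simp only [Metric.mem_closedBall, dist_zero_right, chiw]
  exact le_of_lt hx

lemma bw_out (s : ℝ) : EqOn (bw (n := n) s) (fun _ => 0) {x | 3 < ‖x‖} := by
  intro x hx
  simp only [bw]
  rw [(chiw n).zero_of_le_dist, mul_zero]
  simp only [dist_zero_right, chiw]
  exact le_of_lt hx

lemma bw_mid {s : ℝ} (hs : 0 ≤ s) :
    EqOn (bw (n := n) s) (fun x => Bw (s, x)) {x | 1/2 < ‖x‖ ^ 2} := by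
  intro x hx
  simp only [mem_ofPred_eq] at hx
  simp only [bw, Bw, qw]
  rw [etaw_eq (by linarith)]

lemma open_in : IsOpen {x : En n | ‖x‖ < 2} := isOpen_lt continuous_norm continuous_const
lemma open_out : IsOpen {x : En n | 3 < ‖x‖} := isOpen_lt continuous_const continuous_norm
lemma open_mid : IsOpen {x : En n | 1/2 < ‖x‖ ^ 2} :=
  isOpen_lt continuous_const (continuous_norm.pow 2)

/-- Partial derivatives of slices. -/
lemma pd_slice {F : Type*} [NormedAddCommGroup F] [NormedSpace ℝ F]
    {G : ℝ × F → ℝ} (hG : Sm G) (s : ℝ) (e : F) :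
    pd e (fun x => G (s, x)) = fun x => pd ((0 : ℝ), e) G (s, x) := by
  funext x
  have h2 : HasFDerivAt (fun x => G (s, x)) _ x := (hG.at (s, x)).hasFDerivAt.comp x (hasFDerivAt_prodMk_right s x)
  simp only [pd]
  rw [h2.fderiv]
  simp

lemma sm_slice {F : Type*} [NormedAddCommGroup F] [NormedSpace ℝ F]
    {G : ℝ × F → ℝ} (hG : Sm G) (s : ℝ) : Sm (fun x => G (s, x)) :=
  hG.comp (contDiff_prodMk_right s)

lemma bound_slice (G : ℝ × En n → ℝ) (hG : Sm G) :
    ∃ K : ℝ, 0 ≤ K ∧ ∀ s ∈ Icc (0:ℝ) 1, ∀ x : En n, ‖x‖ ≤ 3 → |G (s, x)| ≤ K := by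
  have hc : IsCompact (Icc (0:ℝ) 1 ×ˢ Metric.closedBall (0 : En n) 3) :=
    isCompact_Icc.prod (isCompact_closedBall _ _)
  obtain ⟨K, hK⟩ := hc.exists_bound_of_continuousOn hG.cont.continuousOn
  refine ⟨max K 0, le_max_right _ _, fun s hs x hx => le_max_of_le_left ?_⟩
  exact hK (s, x) ⟨hs, by simpa using hx⟩

lemma abs_quad_le {m : Fin n → Fin n → ℝ} {K : ℝ} (hm : ∀ j k, |m j k| ≤ K) (ξ : Fin n → ℝ) :
    - (n * K * ∑ j, ξ j ^ 2) ≤ ∑ j, ∑ k, m j k * (ξ j * ξ k) := by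
  have h1 : ∀ j k, - (K / 2 * (ξ j ^ 2 + ξ k ^ 2)) ≤ m j k * (ξ j * ξ k) := by
    intro j k
    have hK : 0 ≤ K := (abs_nonneg _).trans (hm j k)
    have h2 : |m j k * (ξ j * ξ k)| ≤ K * ((ξ j ^ 2 + ξ k ^ 2) / 2) := by
      rw [abs_mul]
      apply mul_le_mul (hm j k) _ (abs_nonneg _) hK
      rw [abs_le]
      constructor <;> nlinarith [sq_nonneg (ξ j + ξ k), sq_nonneg (ξ j - ξ k)]
    have := (abs_le.1 h2).1
    linarith
  have h3 : ∑ j : Fin n, ∑ k : Fin n, - (K / 2 * (ξ j ^ 2 + ξ k ^ 2)) = - (n * K * ∑ j, ξ j ^ 2) := by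
    simp only [mul_add, Finset.sum_neg_distrib, Finset.sum_add_distrib, Finset.sum_const,
      Finset.card_univ, Fintype.card_fin, nsmul_eq_mul, ← Finset.mul_sum]
    ring
  rw [← h3]
  exact Finset.sum_le_sum fun j _ => Finset.sum_le_sum fun k _ => h1 j k

lemma abs_coord_le (x : En n) (k : Fin n) : |x k| ≤ ‖x‖ := by
  simpa using PiLp.norm_apply_le x k

lemma abs_coord_pw {s : ℝ} (hs : 0 < s) (x : En n) (k : Fin n) : |x k * pw s x| ≤ 1 := by
  rw [abs_mul, abs_of_pos (pw_pos hs x), pw, ← div_eq_mul_inv]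
  refine (div_le_one (qw_pos hs x)).2 ?_
  refine (abs_coord_le x k).trans (Real.le_sqrt_of_sq_le ?_)
  linarith

lemma weight_unit (n : ℕ) (hn : 5 ≤ n) : ∃ K : ℝ, 0 < K ∧ ∀ s : ℝ, 0 < s → s ≤ 1 →
    (∀ (x : En n) k, 3 < ‖x‖ → pd (eb k) (bw s) x = 0) ∧
    (∀ (x : En n) k, |pd (eb k) (bw s) x| ≤ K) ∧
    (∀ (x : En n) (ξ : Fin n → ℝ), - (K * ∑ j, ξ j ^ 2) ≤
      ∑ j, ∑ k, pd (eb j) (pd (eb k) (bw s)) x * (ξ j * ξ k)) ∧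
    (∀ x : En n, ‖x‖ ≤ 1 → ∀ k, pd (eb k) (bw s) x = x k * pw s x) ∧
    (∀ x : En n, ‖x‖ ≤ 1 → 8 * pw s x ^ 3 ≤
      - ∑ j, ∑ k, pd (eb j) (pd (eb j) (pd (eb k) (pd (eb k) (bw s)))) x) ∧
    (∀ x : En n, (if ‖x‖ ≤ 3 then -K else 0) ≤
      - ∑ j, ∑ k, pd (eb j) (pd (eb j) (pd (eb k) (pd (eb k) (bw s)))) x) := by
  choose K1 hK1 hB1 using fun k : Fin n => bound_slice (pd ((0:ℝ), eb k) Bw) (sm_Bw.pd _)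
  choose K2 hK2 hB2 using fun j k : Fin n => bound_slice (pd ((0:ℝ), eb j) (pd ((0:ℝ), eb k) Bw))
    ((sm_Bw.pd _).pd _)
  choose K4 hK4 hB4 using fun j k : Fin n => bound_slice
    (pd ((0:ℝ), eb j) (pd ((0:ℝ), eb j) (pd ((0:ℝ), eb k) (pd ((0:ℝ), eb k) Bw))))
    ((((sm_Bw.pd _).pd _).pd _).pd _)
  set S1 := ∑ k, K1 k
  set S2 := ∑ j, ∑ k, K2 j k
  set S4 := ∑ j, ∑ k, K4 j k
  have hS1 : 0 ≤ S1 := Finset.sum_nonneg fun k _ => hK1 k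
  have hS2 : 0 ≤ S2 := Finset.sum_nonneg fun j _ => Finset.sum_nonneg fun k _ => hK2 j k
  have hS4 : 0 ≤ S4 := Finset.sum_nonneg fun j _ => Finset.sum_nonneg fun k _ => hK4 j k
  have l1 : ∀ k, K1 k ≤ S1 := fun k => Finset.single_le_sum (fun k _ => hK1 k) (Finset.mem_univ k)
  have l2 : ∀ j k, K2 j k ≤ S2 := fun j k =>
    (Finset.single_le_sum (fun k _ => hK2 j k) (Finset.mem_univ k)).trans
    (Finset.single_le_sum (f := fun j => ∑ k, K2 j k)
      (fun j _ => Finset.sum_nonneg fun k _ => hK2 j k) (Finset.mem_univ j))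
  have hnS : (0:ℝ) ≤ n * S2 := by positivity
  have key : ∀ s : ℝ, 0 < s →
    (∀ k, EqOn (pd (eb k) (bw s)) (fun x => pd ((0:ℝ), eb k) Bw (s, x)) {x : En n | 1/2 < ‖x‖ ^ 2}) ∧
    (∀ j k, EqOn (pd (eb j) (pd (eb k) (bw s)))
      (fun x => pd ((0:ℝ), eb j) (pd ((0:ℝ), eb k) Bw) (s, x)) {x : En n | 1/2 < ‖x‖ ^ 2}) ∧
    (∀ j k, EqOn (pd (eb j) (pd (eb j) (pd (eb k) (pd (eb k) (bw s)))))
      (fun x => pd ((0:ℝ), eb j) (pd ((0:ℝ), eb j) (pd ((0:ℝ), eb k) (pd ((0:ℝ), eb k) Bw))) (s, x))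
      {x : En n | 1/2 < ‖x‖ ^ 2}) := by
    intro s hs
    have h1 : ∀ k, EqOn (pd (eb k) (bw s)) (fun x => pd ((0:ℝ), eb k) Bw (s, x))
        {x : En n | 1/2 < ‖x‖ ^ 2} := by
      intro k
      have := pd_eqOn open_mid (bw_mid (n := n) hs.le) (eb k)
      rwa [pd_slice sm_Bw] at this
    have h2 : ∀ j k, EqOn (pd (eb j) (pd (eb k) (bw s)))
      (fun x => pd ((0:ℝ), eb j) (pd ((0:ℝ), eb k) Bw) (s, x)) {x : En n | 1/2 < ‖x‖ ^ 2} := by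
      intro j k
      have := pd_eqOn open_mid (h1 k) (eb j)
      rwa [pd_slice (sm_Bw.pd _)] at this
    refine ⟨h1, h2, fun j k => ?_⟩
    have h3 := pd_eqOn open_mid (h2 k k) (eb j)
    rw [pd_slice ((sm_Bw.pd _).pd _)] at h3
    have h4 := pd_eqOn open_mid h3 (eb j)
    rwa [pd_slice (((sm_Bw.pd _).pd _).pd _)] at h4
  refine ⟨1 + S1 + n * S2 + S4, by positivity, fun s hs hs1 => ?_⟩
  obtain ⟨k1, k2, k4⟩ := key s hs
  have hsI : s ∈ Icc (0:ℝ) 1 := ⟨hs.le, hs1⟩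
  have i1 := fun k => pd_eqOn open_in (bw_in (n := n) s) (eb k)
  have i2 := fun j k => pd_eqOn open_in (i1 k) (eb j)
  have i4 := fun j k => pd_eqOn open_in (pd_eqOn open_in (i2 k k) (eb j)) (eb j)
  have z0 : ∀ e : En n, pd e (fun _ : En n => (0:ℝ)) = fun _ => 0 := fun e => by
    funext x; exact pd_const 0 x e
  have o1 : ∀ k, EqOn (pd (eb k) (bw s)) (fun _ => 0) {x : En n | 3 < ‖x‖} := fun k => by
    have := pd_eqOn open_out (bw_out (n := n) s) (eb k)
    rwa [z0] at this
  have o2 : ∀ j k, EqOn (pd (eb j) (pd (eb k) (bw s))) (fun _ => 0) {x : En n | 3 < ‖x‖} := fun j k => by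
    have := pd_eqOn open_out (o1 k) (eb j)
    rwa [z0] at this
  have o4 : ∀ j k, EqOn (pd (eb j) (pd (eb j) (pd (eb k) (pd (eb k) (bw s))))) (fun _ => 0)
      {x : En n | 3 < ‖x‖} := fun j k => by
    have := pd_eqOn open_out (o2 k k) (eb j)
    rw [z0] at this
    have := pd_eqOn open_out this (eb j)
    rwa [z0] at this
  have mid_of : ∀ x : En n, 1 < ‖x‖ → x ∈ {x : En n | 1/2 < ‖x‖ ^ 2} := fun x hx => by
    simp only [mem_ofPred_eq]; nlinarith
  refine ⟨fun x k hx => o1 k hx, fun x k => ?_, fun x ξ => ?_, fun x hx k => ?_, fun x hx => ?_,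
    fun x => ?_⟩
  · rcases lt_or_ge 3 ‖x‖ with h | h
    · rw [o1 k h]; simp; positivity
    rcases lt_or_ge 1 ‖x‖ with h' | h'
    · rw [k1 k (mid_of x h')]
      have := (hB1 k s hsI x h).trans (l1 k)
      linarith
    · have : x ∈ {x : En n | ‖x‖ < 2} := by simp only [mem_ofPred_eq]; linarith
      rw [i1 k this, pd_qw hs]
      have := abs_coord_pw hs x k
      linarith
  · have hX : 0 ≤ ∑ j, ξ j ^ 2 := Finset.sum_nonneg fun j _ => sq_nonneg _
    have hle : - ((1 + S1 + n * S2 + S4) * ∑ j, ξ j ^ 2) ≤ - (n * S2 * ∑ j, ξ j ^ 2) := by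
      nlinarith
    have hle0 : - ((1 + S1 + n * S2 + S4) * ∑ j, ξ j ^ 2) ≤ 0 := by
      have : 0 ≤ (1 + S1 + n * S2 + S4) * ∑ j, ξ j ^ 2 := by positivity
      linarith
    rcases lt_or_ge 3 ‖x‖ with h | h
    · have : ∑ j, ∑ k, pd (eb j) (pd (eb k) (bw s)) x * (ξ j * ξ k) = 0 := by
        refine Finset.sum_eq_zero fun j _ => Finset.sum_eq_zero fun k _ => ?_
        rw [o2 j k h]; simp
      rw [this]; exact hle0
    rcases lt_or_ge 1 ‖x‖ with h' | h'
    · refine hle.trans (abs_quad_le (fun j k => ?_) ξ)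
      rw [k2 j k (mid_of x h')]
      exact (hB2 j k s hsI x h).trans (l2 j k)
    · have hx2 : x ∈ {x : En n | ‖x‖ < 2} := by simp only [mem_ofPred_eq]; linarith
      refine hle0.trans ?_
      have := hess_qw_nonneg hs x ξ
      refine this.trans_eq (Finset.sum_congr rfl fun j _ => Finset.sum_congr rfl fun k _ => ?_)
      rw [i2 j k hx2]
  · have hx2 : x ∈ {x : En n | ‖x‖ < 2} := by simp only [mem_ofPred_eq]; linarith
    rw [i1 k hx2, pd_qw hs]
  · have hx2 : x ∈ {x : En n | ‖x‖ < 2} := by simp only [mem_ofPred_eq]; linarith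
    have := bilap_qw hs hn x
    have e : ∑ j, ∑ k, pd (eb j) (pd (eb j) (pd (eb k) (pd (eb k) (bw s)))) x
      = ∑ j, ∑ k, pd (eb j) (pd (eb j) (pd (eb k) (pd (eb k) (qw s)))) x :=
      Finset.sum_congr rfl fun j _ => Finset.sum_congr rfl fun k _ => i4 j k hx2
    rw [e]; linarith
  · rcases lt_or_ge 3 ‖x‖ with h | h
    · rw [if_neg (not_le.2 h)]
      have : ∑ j, ∑ k, pd (eb j) (pd (eb j) (pd (eb k) (pd (eb k) (bw s)))) x = 0 :=
        Finset.sum_eq_zero fun j _ => Finset.sum_eq_zero fun k _ => o4 j k h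
      rw [this]; simp
    rw [if_pos h]
    rcases lt_or_ge 1 ‖x‖ with h' | h'
    · have : ∑ j, ∑ k, pd (eb j) (pd (eb j) (pd (eb k) (pd (eb k) (bw s)))) x ≤ S4 := by
        refine Finset.sum_le_sum fun j _ => Finset.sum_le_sum fun k _ => ?_
        rw [k4 j k (mid_of x h')]
        exact (le_abs_self _).trans (hB4 j k s hsI x h)
      linarith
    · have hx2 : x ∈ {x : En n | ‖x‖ < 2} := by simp only [mem_ofPred_eq]; linarith
      have := bilap_qw hs hn x
      have hp := pw_pos hs x
      have hp3 : 0 < pw s x ^ 3 := by positivity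
      have e : ∑ j, ∑ k, pd (eb j) (pd (eb j) (pd (eb k) (pd (eb k) (bw s)))) x
        = ∑ j, ∑ k, pd (eb j) (pd (eb j) (pd (eb k) (pd (eb k) (qw s)))) x :=
        Finset.sum_congr rfl fun j _ => Finset.sum_congr rfl fun k _ => i4 j k hx2
      rw [e]; linarith

/-- Properties of an admissible Morawetz weight at scale `R` with regularisation `ε²`. -/
structure IsWeight (n : ℕ) (K R e : ℝ) (a : En n → ℝ) : Prop where
  sm : Sm a
  cs : HasCompactSupport a
  out : ∀ (x : En n) k, 3 * R < ‖x‖ → pd (eb k) a x = 0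
  grad : ∀ (x : En n) k, |pd (eb k) a x| ≤ K
  hess : ∀ (x : En n) (ξ : Fin n → ℝ), - (K / R * ∑ j, ξ j ^ 2) ≤
      ∑ j, ∑ k, pd (eb j) (pd (eb k) a) x * (ξ j * ξ k)
  gradin : ∀ x : En n, ‖x‖ ≤ R → ∀ k, pd (eb k) a x = x k * pw e x
  bilap_in : ∀ x : En n, ‖x‖ ≤ R → 8 * pw e x ^ 3 ≤
      - ∑ j, ∑ k, pd (eb j) (pd (eb j) (pd (eb k) (pd (eb k) a))) x
  bilap : ∀ x : En n, (if ‖x‖ ≤ 3 * R then - (K / R ^ 3) else 0) ≤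
      - ∑ j, ∑ k, pd (eb j) (pd (eb j) (pd (eb k) (pd (eb k) a))) x

lemma pw_scale {s R : ℝ} (hR : 0 < R) (x : En n) :
    pw s (R⁻¹ • x) = R * pw (s * R ^ 2) x := by
  unfold pw
  rw [norm_smul, Real.norm_of_nonneg (inv_nonneg.2 hR.le)]
  have : ‖x‖ ^ 2 + s * R ^ 2 = R ^ 2 * ((R⁻¹ * ‖x‖) ^ 2 + s) := by
    field_simp
  rw [this, Real.sqrt_mul (by positivity), Real.sqrt_sq hR.le, mul_inv, ← mul_assoc,
    mul_inv_cancel₀ hR.ne', one_mul]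

lemma weight_exists (n : ℕ) (hn : 5 ≤ n) : ∃ K : ℝ, 0 < K ∧ ∀ R : ℝ, 0 < R → ∀ s : ℝ, 0 < s → s ≤ 1 →
    ∃ a : En n → ℝ, IsWeight n K R (s * R ^ 2) a := by
  obtain ⟨K, hK, H⟩ := weight_unit n hn
  refine ⟨K, hK, fun R hR s hs hs1 => ⟨fun x => R * bw s (R⁻¹ • x), ?_⟩⟩
  obtain ⟨h1, h2, h3, h4, h5, h6⟩ := H s hs hs1
  have sb := sm_bw (n := n) hs
  have sc : ∀ {f : En n → ℝ}, Sm f → Sm (fun x => f (R⁻¹ • x)) := fun hf =>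
    hf.comp (contDiff_const_smul _)
  have sca : ∀ (c : ℝ) (e : En n) {f : En n → ℝ}, Sm f →
      pd e (fun x => c * f (R⁻¹ • x)) = fun x => (c * R⁻¹) * pd e f (R⁻¹ • x) := by
    intro c e f hf
    funext x
    rw [pd_const_mul _ ((sc hf).at x), pd_comp_smul hf.diff]
    ring
  have d1 : ∀ k, pd (eb k) (fun x => R * bw s (R⁻¹ • x)) = fun x : En n => pd (eb k) (bw s) (R⁻¹ • x) := by
    intro k
    rw [sca _ _ sb]
    funext x
    rw [mul_inv_cancel₀ hR.ne', one_mul]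
  have d1' : ∀ k, pd (eb k) (fun x => R * bw s (R⁻¹ • x)) = fun x : En n => 1 * pd (eb k) (bw s) (R⁻¹ • x) := by
    intro k; rw [d1]; simp
  have d2 : ∀ j k, pd (eb j) (pd (eb k) (fun x => R * bw s (R⁻¹ • x)))
      = fun x : En n => (1 * R⁻¹) * pd (eb j) (pd (eb k) (bw s)) (R⁻¹ • x) := by
    intro j k
    rw [d1', sca _ _ (sb.pd _)]
  have d4 : ∀ j k, pd (eb j) (pd (eb j) (pd (eb k) (pd (eb k) (fun x => R * bw s (R⁻¹ • x)))))
      = fun x : En n => (1 * R⁻¹ * R⁻¹ * R⁻¹) * pd (eb j) (pd (eb j) (pd (eb k) (pd (eb k) (bw s)))) (R⁻¹ • x) := by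
    intro j k
    rw [d2, sca _ _ ((sb.pd _).pd _), sca _ _ (((sb.pd _).pd _).pd _)]
  have nrm : ∀ x : En n, ‖R⁻¹ • x‖ = ‖x‖ / R := fun x => by
    rw [norm_smul, Real.norm_of_nonneg (inv_nonneg.2 hR.le)]; field_simp
  have hR' : 0 < R⁻¹ := inv_pos.2 hR
  have B : ∀ x : En n, - ∑ j, ∑ k, pd (eb j) (pd (eb j) (pd (eb k) (pd (eb k) (fun x => R * bw s (R⁻¹ • x))))) x
      = R⁻¹ ^ 3 * (- ∑ j, ∑ k, pd (eb j) (pd (eb j) (pd (eb k) (pd (eb k) (bw s)))) (R⁻¹ • x)) := by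
    intro x
    simp only [d4, ← Finset.mul_sum]
    ring
  refine ⟨(sc sb).cmul R, ?_, ?_, ?_, ?_, ?_, ?_, ?_⟩
  · exact (HasCompactSupport.comp_smul cs_bw hR'.ne').mul_left
  · intro x k hx
    rw [d1]
    apply h1
    rw [nrm, lt_div_iff₀ hR]; exact hx
  · intro x k
    rw [d1]; exact h2 _ _
  · intro x ξ
    simp only [d2]
    have := mul_le_mul_of_nonneg_left (h3 (R⁻¹ • x) ξ) hR'.le
    calc _ = R⁻¹ * -(K * ∑ j, ξ j ^ 2) := by rw [div_eq_mul_inv]; ring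
      _ ≤ _ := this
      _ = _ := by
        simp only [Finset.mul_sum]
        refine Finset.sum_congr rfl fun j _ => Finset.sum_congr rfl fun k _ => ?_
        ring
  · intro x hx k
    rw [d1]
    simp only
    rw [h4 _ (by rw [nrm, div_le_one hR]; exact hx), pw_scale hR]
    simp only [PiLp.smul_apply, smul_eq_mul]
    field_simp
  · intro x hx
    rw [B]
    have := mul_le_mul_of_nonneg_left (h5 (R⁻¹ • x) (by rw [nrm, div_le_one hR]; exact hx))
      (pow_pos hR' 3).le
    refine le_trans (le_of_eq ?_) this
    rw [pw_scale hR]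
    field_simp
  · intro x
    rw [B]
    have := mul_le_mul_of_nonneg_left (h6 (R⁻¹ • x)) (pow_pos hR' 3).le
    refine le_trans (le_of_eq ?_) this
    simp only [nrm, div_le_iff₀ hR]
    split_ifs
    · field_simp
    · simp

end weight2


section Hardy
variable {n : ℕ}

/-- Bounded smooth functions with square integrable gradient. -/
structure Nice (f : En n → ℝ) : Prop where
  sm : Sm f
  bdd : ∃ B, ∀ x, |f x| ≤ B
  isq : Integrable (fun x => f x ^ 2)
  igrad : ∀ j, Integrable (fun x => pd (eb j) f x ^ 2)

lemma pw_le_inv {R : ℝ} (hR : 0 < R) (x : En n) : pw (R ^ 2) x ≤ R⁻¹ := by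
  unfold pw
  apply inv_anti₀ hR
  apply Real.le_sqrt_of_sq_le
  nlinarith [sq_nonneg ‖x‖]

lemma ball_le_pw {R : ℝ} (hR : 0 < R) (x : En n) (hx : ‖x‖ ≤ 3 * R) :
    1 ≤ 10 * R ^ 2 * pw (R ^ 2) x ^ 2 := by
  have h := pw_sq (s := R ^ 2) (by positivity) x
  have h2 : ‖x‖ ^ 2 + R ^ 2 ≤ 10 * R ^ 2 := by nlinarith [norm_nonneg x]
  have := sq_nonneg (pw (R ^ 2) x)
  nlinarith

lemma integrable_mul_of_sq {f g : En n → ℝ} (hf : Continuous f) (hg : Continuous g)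
    (h1 : Integrable (fun x => f x ^ 2)) (h2 : Integrable (fun x => g x ^ 2)) :
    Integrable (fun x => f x * g x) := by
  apply (h1.add h2).mono' (hf.mul hg).aestronglyMeasurable
  filter_upwards with x
  simp only [Pi.add_apply, Pi.mul_apply, Real.norm_eq_abs, abs_mul]
  nlinarith [sq_nonneg (|f x| - |g x|), sq_abs (f x), sq_abs (g x), sq_nonneg (f x), sq_nonneg (g x)]

lemma hardy (hn : 5 ≤ n) {f : En n → ℝ} (hf : Nice f) {R : ℝ} (hR : 0 < R) :
    2 * ∫ x, f x ^ 2 * pw (R ^ 2) x ^ 2 ≤ ∫ x, ∑ j, pd (eb j) f x ^ 2 := by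
  have hs : (0:ℝ) < R ^ 2 := by positivity
  have sg : Sm (pw (n := n) (R ^ 2)) := sm_pw hs
  have sF : ∀ j : Fin n, Sm (fun x : En n => f x ^ 2 * (x j * pw (R ^ 2) x ^ 2)) := fun j =>
    (hf.sm.pow 2).mul ((sm_coord j).mul (sg.pow 2))
  have hpd : ∀ (j : Fin n) (x : En n), pd (eb j) (fun x : En n => f x ^ 2 * (x j * pw (R ^ 2) x ^ 2)) x
      = (2 * (x j * pw (R ^ 2) x ^ 2)) * (f x * pd (eb j) f x)
        + (pw (R ^ 2) x ^ 2 - 2 * x j ^ 2 * pw (R ^ 2) x ^ 4) * f x ^ 2 := by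
    intro j x
    have sf2 : Sm (fun x : En n => f x ^ 2) := hf.sm.pow 2
    have sg2 : Sm (fun x : En n => pw (R ^ 2) x ^ 2) := sg.pow 2
    rw [pd_mul (sf2.at x) (((sm_coord j).mul sg2).at x),
      pd_mul ((sm_coord j).at x) (sg2.at x), pd_pow (hf.sm.at x) 1, pd_pow (sg.at x) 1,
      pd_coord, pd_pw hs]
    simp; ring
  have cx : ∀ j : Fin n, Continuous (fun x : En n => x j) := fun j => (sm_coord j).cont
  have cp := sg.cont
  have cf := hf.sm.cont
  have b1 : ∀ (j : Fin n) (x : En n), |x j * pw (R ^ 2) x| ≤ 1 := fun j x => abs_coord_pw hs x j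
  have b2 : ∀ (x : En n), |pw (R ^ 2) x| ≤ R⁻¹ := fun x => by
    rw [abs_of_pos (pw_pos hs x)]; exact pw_le_inv hR x
  have i0 : Integrable (fun x : En n => f x ^ 2 * pw (R ^ 2) x ^ 2) := by
    apply hf.isq.mul_bdd (c := R⁻¹ ^ 2) (by fun_prop)
    filter_upwards with x
    rw [norm_pow]; gcongr; exact b2 x
  have i1 : ∀ j, Integrable (fun x : En n => f x ^ 2 * (x j * pw (R ^ 2) x ^ 2)) := by
    intro j
    apply hf.isq.mul_bdd (c := 1 * R⁻¹) ((cx j).mul (cp.pow 2)).aestronglyMeasurable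
    filter_upwards with x
    show ‖x j * pw (R ^ 2) x ^ 2‖ ≤ _
    rw [show x j * pw (R ^ 2) x ^ 2 = (x j * pw (R ^ 2) x) * pw (R ^ 2) x by ring, norm_mul]
    gcongr
    · exact b1 j x
    · exact b2 x
  have i2 : ∀ j, Integrable (pd (eb j) (fun x : En n => f x ^ 2 * (x j * pw (R ^ 2) x ^ 2))) := by
    intro j
    rw [funext (hpd j)]
    have := cx j
    apply Integrable.add
    · apply (integrable_mul_of_sq cf (hf.sm.pd _).cont hf.isq (hf.igrad j)).bdd_mul (c := 2 * (1 * R⁻¹))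
      · fun_prop
      · filter_upwards with x
        rw [show 2 * (x j * pw (R ^ 2) x ^ 2) = 2 * ((x j * pw (R ^ 2) x) * pw (R ^ 2) x) by ring,
          norm_mul, norm_mul]
        rw [show ‖(2:ℝ)‖ = 2 by norm_num]
        gcongr
        · exact b1 j x
        · exact b2 x
    · apply hf.isq.bdd_mul (c := R⁻¹ ^ 2 + 2 * (1 * R⁻¹) ^ 2)
      · fun_prop
      · filter_upwards with x
        refine (norm_sub_le _ _).trans ?_
        rw [show 2 * x j ^ 2 * pw (R ^ 2) x ^ 4 = 2 * ((x j * pw (R ^ 2) x) * pw (R ^ 2) x) ^ 2 by ring,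
          norm_mul, norm_pow, norm_pow, norm_mul, show ‖(2:ℝ)‖ = 2 by norm_num]
        gcongr
        · exact b2 x
        · exact b1 j x
        · exact b2 x
  have tot : ∫ x, ∑ j, pd (eb j) (fun x : En n => f x ^ 2 * (x j * pw (R ^ 2) x ^ 2)) x = 0 := by
    rw [integral_finsetSum _ (fun j _ => i2 j)]
    exact Finset.sum_eq_zero fun j _ => integral_pd_zero _ (sF j).diff (i1 j) (i2 j)
  have ig : Integrable (fun x => ∑ j, pd (eb j) f x ^ 2) := integrable_finsetSum _ fun j _ => hf.igrad j
  have key : ∫ x, (2 * (f x ^ 2 * pw (R ^ 2) x ^ 2) - ∑ j, pd (eb j) f x ^ 2) ≤ 0 := by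
    rw [← tot]
    apply integral_mono ((i0.const_mul 2).sub ig) (integrable_finsetSum _ fun j _ => i2 j)
    intro x
    simp only [hpd]
    set g := pw (R ^ 2) x
    have e1 : ∑ j, ((2 * (x j * g ^ 2)) * (f x * pd (eb j) f x) + (g ^ 2 - 2 * x j ^ 2 * g ^ 4) * f x ^ 2)
       ≥ ∑ j, (- pd (eb j) f x ^ 2 + (g ^ 2 - 3 * x j ^ 2 * g ^ 4) * f x ^ 2) := by
      apply Finset.sum_le_sum
      intro j _
      nlinarith [sq_nonneg (pd (eb j) f x + x j * g ^ 2 * f x)]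
    refine le_trans ?_ e1
    have e2 : ∑ j, (- pd (eb j) f x ^ 2 + (g ^ 2 - 3 * x j ^ 2 * g ^ 4) * f x ^ 2)
       = - ∑ j, pd (eb j) f x ^ 2 + ((n:ℝ) * g ^ 2 - 3 * ‖x‖ ^ 2 * g ^ 4) * f x ^ 2 := by
      rw [Finset.sum_add_distrib, Finset.sum_neg_distrib, ← Finset.sum_mul, Finset.sum_sub_distrib,
        ← Finset.sum_mul, ← Finset.mul_sum, sum_coord_sq]
      simp
    rw [e2]
    have h := pw_sq hs x
    have h3 : ‖x‖ ^ 2 * g ^ 4 ≤ g ^ 2 := by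
      have : ‖x‖ ^ 2 * g ^ 4 = g ^ 2 - R ^ 2 * g ^ 4 := by linear_combination g ^ 2 * h
      rw [this]; have : 0 ≤ R ^ 2 * g ^ 4 := by positivity
      linarith
    have hn' : (5:ℝ) ≤ n := by exact_mod_cast hn
    have h4 : 2 * g ^ 2 ≤ (n:ℝ) * g ^ 2 - 3 * ‖x‖ ^ 2 * g ^ 4 := by nlinarith [sq_nonneg g]
    show 2 * (f x ^ 2 * g ^ 2) - ∑ j, pd (eb j) f x ^ 2 ≤ _
    nlinarith [mul_le_mul_of_nonneg_right h4 (sq_nonneg (f x))]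
  rw [integral_sub (i0.const_mul 2) ig, integral_const_mul] at key
  linarith

end Hardy

section Kernel
variable {n : ℕ}

lemma integrableOn_inv_pow (hn : 5 ≤ n) {m : ℕ} (hm : m ≤ 4) (r : ℝ) :
    IntegrableOn (fun x : En n => (‖x‖ ^ m)⁻¹) (Metric.closedBall 0 r) := by
  have : LocallyIntegrable (fun x : En n => (‖x‖ ^ m)⁻¹) := by
    apply locallyIntegrable_of_norm_le_rpow (α := m) (C := 1)
    · simp only [finrank_euclideanSpace, Fintype.card_fin]; exact_mod_cast (by omega : m < n)
    · filter_upwards with x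
      rw [one_mul, Real.rpow_neg (norm_nonneg _), Real.rpow_natCast]
      simp
    · exact (by fun_prop : Measurable (fun x : En n => (‖x‖ ^ m)⁻¹)).aestronglyMeasurable
    · simp only [finrank_euclideanSpace, Fintype.card_fin]; omega
  exact this.integrableOn_isCompact (isCompact_closedBall _ _)

/-- The singular kernel acting on integrable and bounded functions. -/
lemma kernel_integrable (hn : 5 ≤ n) {m : ℕ} (hm : m ≤ 4) {f g : En n → ℝ} (hf : Integrable f) (hg : Integrable g)
    {B : ℝ} (hB : ∀ x, |g x| ≤ B) :
    Integrable (fun p : En n × En n => (‖p.1 - p.2‖ ^ m)⁻¹ * (f p.1 * g p.2)) := by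
  set k : En n → ℝ := (Metric.closedBall 0 1).indicator (fun x : En n => (‖x‖ ^ m)⁻¹) with hk
  have ik : Integrable k := by
    rw [hk, integrable_indicator_iff Metric.isClosed_closedBall.measurableSet]
    exact integrableOn_inv_pow hn hm 1
  have mk : Measurable (fun x : En n => (‖x‖ ^ m)⁻¹) := by fun_prop
  have I1 : Integrable (fun p : En n × En n => f p.2 * k (p.1 - p.2)) :=
    hf.convolution_integrand (ContinuousLinearMap.mul ℝ ℝ) ik
  have I2 : Integrable (fun p : En n × En n => f p.1 * k (p.2 - p.1)) := I1.swap
  have I3 : Integrable (fun p : En n × En n => (f p.1 * k (p.2 - p.1)) * g p.2) := by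
    apply I2.mul_bdd (c := B)
    · exact hg.aestronglyMeasurable.comp_snd
    · filter_upwards with p; exact hB _
  have I4 : Integrable (fun p : En n × En n => f p.1 * g p.2) := hf.mul_prod hg
  have I5 : Integrable (fun p : En n × En n => ((‖p.1 - p.2‖ ^ m)⁻¹ - k (p.2 - p.1)) * (f p.1 * g p.2)) := by
    apply I4.bdd_mul (c := 1)
    · have h1 : Measurable k := mk.indicator Metric.isClosed_closedBall.measurableSet
      have : Measurable (fun p : En n × En n => (‖p.1 - p.2‖ ^ m)⁻¹ - k (p.2 - p.1)) := by fun_prop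
      exact this.aestronglyMeasurable
    · filter_upwards with p
      simp only [hk, indicator]
      split_ifs with h
      · rw [norm_sub_rev p.1 p.2]; simp
      · simp only [Metric.mem_closedBall, dist_zero_right, not_le] at h
        rw [sub_zero, norm_inv, norm_pow, norm_norm, norm_sub_rev]
        exact inv_le_one_of_one_le₀ (one_le_pow₀ h.le)
  have := I3.add I5
  refine this.congr ?_
  filter_upwards with p
  simp only [Pi.add_apply]; ring

end Kernel


section Nonlin
variable {n : ℕ}

lemma pw_le_norm_inv {s : ℝ} (hs : 0 ≤ s) {z : En n} (hz : z ≠ 0) : pw s z ≤ ‖z‖⁻¹ := by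
  unfold pw
  have hz' : 0 < ‖z‖ := norm_pos_iff.2 hz
  apply inv_anti₀ hz'
  apply Real.le_sqrt_of_sq_le
  linarith

lemma pw_anti {s t : ℝ} (hs : 0 < s) (hst : s ≤ t) (z : En n) : pw t z ≤ pw s z := by
  unfold pw
  apply inv_anti₀ (Real.sqrt_pos.2 (base_pos hs z))
  apply Real.sqrt_le_sqrt
  linarith

lemma noAtoms_En (hn : 5 ≤ n) : NullSingletonClass (volume : Measure (En n)) := by
  have : Nonempty (Fin n) := ⟨⟨0, by omega⟩⟩
  have : Nontrivial (En n) := inferInstance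
  infer_instance

lemma ae_ne (hn : 5 ≤ n) : ∀ᵐ p : En n × En n, p.1 ≠ p.2 := by
  have := noAtoms_En hn
  have hm : MeasurableSet {p : En n × En n | p.1 = p.2} :=
    (isClosed_eq continuous_fst continuous_snd).measurableSet
  have h0 : (volume : Measure (En n × En n)) {p : En n × En n | p.1 = p.2} = 0 := by
    rw [Measure.volume_eq_prod, Measure.measure_prod_null hm]
    filter_upwards with x
    have : Prod.mk x ⁻¹' {p : En n × En n | p.1 = p.2} = {x} := by
      ext y; simp [eq_comm]
    rw [this]; simp
  exact measure_eq_zero_iff_ae_notMem.1 h0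

lemma semiconvex {a : En n → ℝ} (ha : Sm a) {C : ℝ}
    (h : ∀ (x : En n) (ξ : Fin n → ℝ), - (C * ∑ j, ξ j ^ 2) ≤
      ∑ j, ∑ k, pd (eb j) (pd (eb k) a) x * (ξ j * ξ k)) (x y : En n) :
    - (C * ‖x - y‖ ^ 2) ≤ ∑ k, (x k - y k) * (pd (eb k) a x - pd (eb k) a y) := by
  set z := x - y with hz
  have hzdec : z = ∑ j, z j • eb j := by
    ext i
    simp [Finset.sum_apply, Pi.single_apply]
  have hd : ∀ k t, HasDerivAt (fun t : ℝ => pd (eb k) a (y + t • z))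
      (∑ j, z j * pd (eb j) (pd (eb k) a) (y + t • z)) t := by
    intro k t
    have h1 : HasDerivAt (fun t : ℝ => y + t • z) z t := by
      simpa using ((hasDerivAt_id t).smul_const z).const_add y
    have h2 := ((ha.pd (eb k)).at (y + t • z)).hasFDerivAt.comp_hasDerivAt t h1
    have h3 : (fderiv ℝ (pd (eb k) a) (y + t • z)) z = ∑ j, z j * pd (eb j) (pd (eb k) a) (y + t • z) := by
      have h4 : ∀ L : En n →L[ℝ] ℝ, L z = ∑ j, z j * L (eb j) := by
        intro L
        conv_lhs => rw [hzdec]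
        rw [map_sum]
        simp only [map_smul, smul_eq_mul]
      exact h4 _
    rw [← h3]
    exact h2
  have hD : ∀ t, HasDerivAt (fun t : ℝ => ∑ k, z k * pd (eb k) a (y + t • z))
      (∑ k, z k * ∑ j, z j * pd (eb j) (pd (eb k) a) (y + t • z)) t := fun t =>
    HasDerivAt.fun_sum fun k _ => (hd k t).const_mul _
  have := mul_sub_le_image_sub_of_le_deriv (f := fun t : ℝ => ∑ k, z k * pd (eb k) a (y + t • z))
    (fun t => (hD t).differentiableAt) (C := - (C * ‖z‖ ^ 2)) (by
      intro t
      rw [(hD t).deriv, ← sum_coord_sq]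
      refine (h (y + t • z) (fun j => z j)).trans (le_of_eq ?_)
      rw [Finset.sum_comm]
      apply Finset.sum_congr rfl; intro k _
      rw [Finset.mul_sum]
      apply Finset.sum_congr rfl; intro j _
      ring) (zero_le_one)
  simp only [sub_zero, mul_one, one_smul, zero_smul, add_zero] at this
  refine this.trans (le_of_eq ?_)
  rw [← Finset.sum_sub_distrib]
  apply Finset.sum_congr rfl; intro k _
  rw [hz]; simp; ring

/-- Regularised monotone quantity. -/
def Dm (e : ℝ) (x y : En n) : ℝ := ∑ k, (x k - y k) * (x k * pw e x - y k * pw e y)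

lemma Dm_nonneg {e : ℝ} (he : 0 < e) (x y : En n) : 0 ≤ Dm e x y := by
  have := semiconvex (sm_qw he) (C := 0) (fun x ξ => by simpa using hess_qw_nonneg he x ξ) x y
  simpa [pd_qw he, Dm] using this

lemma pd_kernel {d : ℝ} (hd : 0 < d) (y x : En n) (k : Fin n) :
    pd (eb k) (fun x => pw (d ^ 2) (x - y) ^ 4) x = - (4 * ((x k - y k) * pw (d ^ 2) (x - y) ^ 6)) := by
  have hs : 0 < d ^ 2 := by positivity
  have h1 : pd (eb k) (fun x => pw (d ^ 2) (x - y) ^ 4) x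
      = pd (eb k) (fun x => pw (d ^ 2) x ^ 4) (x - y) := by
    simp only [pd]
    rw [fderiv_comp_sub (f := fun x => pw (d ^ 2) x ^ 4)]
  rw [h1, pd_pow ((sm_pw hs).at _), pd_pw hs]
  simp; ring

lemma kernel_ibp {d : ℝ} (hd : 0 < d) {F : En n → ℝ} (hF : Sm F) (hc : HasCompactSupport F)
    (k : Fin n) (y : En n) :
    ∫ x, pw (d ^ 2) (x - y) ^ 4 * pd (eb k) F x
      = ∫ x, 4 * ((x k - y k) * pw (d ^ 2) (x - y) ^ 6) * F x := by
  have hs : 0 < d ^ 2 := by positivity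
  have sk : Sm (fun x => pw (d ^ 2) (x - y) ^ 4) :=
    ((sm_pw hs).comp (contDiff_id.sub contDiff_const)).pow 4
  have cp : Continuous (fun x => pw (d ^ 2) (x - y)) := (sm_pw hs).cont.comp (by fun_prop)
  have z := integral_pd_zero_cs (eb k) (sk.mul hF) hc.mul_left
  have e : ∀ x, pd (eb k) (fun x => pw (d ^ 2) (x - y) ^ 4 * F x) x
     = pw (d ^ 2) (x - y) ^ 4 * pd (eb k) F x - 4 * ((x k - y k) * pw (d ^ 2) (x - y) ^ 6) * F x := by
    intro x
    rw [pd_mul (sk.at x) (hF.at x), pd_kernel hd]; ring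
  simp only [e] at z
  have cx : Continuous (fun x : En n => x k) := (sm_coord k).cont
  have c1 := (hF.pd (eb k)).cont
  have c2 := hF.cont
  rw [integral_sub] at z
  · linarith
  · exact (by fun_prop : Continuous _).integrable_of_hasCompactSupport (hc.pd _).mul_left
  · exact (by fun_prop : Continuous (fun x : En n => 4 * ((x k - y k) * pw (d ^ 2) (x - y) ^ 6) * F x)).integrable_of_hasCompactSupport hc.mul_left

lemma bdd_of_cs {F : En n → ℝ} (hF : Continuous F) (hc : HasCompactSupport F) : ∃ B, ∀ x, |F x| ≤ B := by
  obtain ⟨B, hB⟩ := hc.exists_bound_of_continuous hF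
  exact ⟨B, hB⟩

lemma integrable_reg {d : ℝ} (hd : 0 < d) {f g : En n → ℝ} (hf : Integrable f) (hg : Integrable g) (k : Fin n) :
    Integrable (fun p : En n × En n => 4 * ((p.1 k - p.2 k) * pw (d ^ 2) (p.1 - p.2) ^ 6) * f p.1 * g p.2) := by
  have hs : 0 < d ^ 2 := by positivity
  have cx : Continuous (fun x : En n => x k) := (sm_coord k).cont
  have cp : Continuous (fun p : En n × En n => pw (d ^ 2) (p.1 - p.2)) := (sm_pw hs).cont.comp (by fun_prop)
  have I := (hf.mul_prod hg).bdd_mul (f := fun p : En n × En n => 4 * ((p.1 k - p.2 k) * pw (d ^ 2) (p.1 - p.2) ^ 6))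
    (c := 4 * (1 * d⁻¹ ^ 5))
    (by have := cx.comp (continuous_fst (X := En n) (Y := En n))
        have := cx.comp (continuous_snd (X := En n) (Y := En n))
        simp only [Function.comp_def] at *
        exact (by fun_prop : Continuous _).aestronglyMeasurable)
    (by
      filter_upwards with p
      have h1 : |p.1 k - p.2 k| * pw (d ^ 2) (p.1 - p.2) ≤ 1 := by
        have := abs_coord_pw hs (p.1 - p.2) k
        rwa [abs_mul, abs_of_pos (pw_pos hs _)] at this
      rw [show 4 * ((p.1 k - p.2 k) * pw (d ^ 2) (p.1 - p.2) ^ 6)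
        = 4 * ((p.1 k - p.2 k) * pw (d ^ 2) (p.1 - p.2) * pw (d ^ 2) (p.1 - p.2) ^ 5) by ring]
      rw [norm_mul, norm_mul, norm_mul, norm_pow, Real.norm_of_nonneg (pw_pos hs _).le]
      rw [show ‖(4:ℝ)‖ = 4 by norm_num]
      have := pw_le_inv hd (p.1 - p.2)
      have := (pw_pos hs (p.1 - p.2)).le
      gcongr
      exact h1)
  refine I.congr ?_
  filter_upwards with p
  ring

end Nonlin


section Nonlin2
variable {n : ℕ}

/-- The divergence of `ρ ∇a`. -/
def gdiv (a ρ : En n → ℝ) (x : En n) : ℝ := ∑ k, pd (eb k) (fun x => ρ x * pd (eb k) a x) x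

lemma pw_neg (s : ℝ) (x : En n) : pw s (-x) = pw s x := by simp [pw]

lemma reg_identity {a ρ : En n → ℝ} (ha : Sm a) (hc : HasCompactSupport a) (hρ : Sm ρ)
    (hi : Integrable ρ) {d : ℝ} (hd : 0 < d) :
    2 * ∫ p : En n × En n, pw (d ^ 2) (p.1 - p.2) ^ 4 * (gdiv a ρ p.1 * ρ p.2)
    = ∫ p : En n × En n, 4 * pw (d ^ 2) (p.1 - p.2) ^ 6 *
        (∑ k, (p.1 k - p.2 k) * (pd (eb k) a p.1 - pd (eb k) a p.2)) * (ρ p.1 * ρ p.2) := by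
  have hs : 0 < d ^ 2 := by positivity
  let F : Fin n → En n → ℝ := fun k x => ρ x * pd (eb k) a x
  have sF : ∀ k, Sm (F k) := fun k => hρ.mul (ha.pd _)
  have cF : ∀ k, HasCompactSupport (F k) := fun k => (hc.pd _).mul_left
  have iF : ∀ k, Integrable (F k) := fun k => (sF k).cont.integrable_of_hasCompactSupport (cF k)
  have iF' : ∀ k, Integrable (pd (eb k) (F k)) := fun k =>
    ((sF k).pd _).cont.integrable_of_hasCompactSupport ((cF k).pd _)
  have cp : Continuous (fun p : En n × En n => pw (d ^ 2) (p.1 - p.2)) := (sm_pw hs).cont.comp (by fun_prop)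
  have i1 : ∀ k, Integrable (fun p : En n × En n => pw (d ^ 2) (p.1 - p.2) ^ 4 * (pd (eb k) (F k) p.1 * ρ p.2)) := by
    intro k
    apply ((iF' k).mul_prod hi).bdd_mul (c := d⁻¹ ^ 4) (cp.pow 4).aestronglyMeasurable
    filter_upwards with p
    show ‖pw (d ^ 2) (p.1 - p.2) ^ 4‖ ≤ _
    rw [norm_pow, Real.norm_of_nonneg (pw_pos hs _).le]
    have := (pw_pos hs (p.1 - p.2)).le
    gcongr
    exact pw_le_inv hd _
  let G : Fin n → En n × En n → ℝ := fun k p => 4 * ((p.1 k - p.2 k) * pw (d ^ 2) (p.1 - p.2) ^ 6) * F k p.1 * ρ p.2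
  have iG : ∀ k, Integrable (G k) := fun k => integrable_reg hd (iF k) hi k
  have e1 : ∀ k, ∫ p : En n × En n, pw (d ^ 2) (p.1 - p.2) ^ 4 * (pd (eb k) (F k) p.1 * ρ p.2)
      = ∫ p, G k p := by
    intro k
    have a1 := integral_prod_symm (μ := (volume : Measure (En n))) (ν := (volume : Measure (En n))) _ (i1 k)
    have a2 := integral_prod_symm (μ := (volume : Measure (En n))) (ν := (volume : Measure (En n))) _ (iG k)
    rw [Measure.volume_eq_prod, a1, a2]
    congr 1; funext y
    simp only [G, ← mul_assoc]
    rw [integral_mul_const, integral_mul_const]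
    have := kernel_ibp hd (sF k) (cF k) k y
    simp only [← mul_assoc] at this
    rw [this]
  have e2 : ∀ k, ∫ p, G k p = ∫ p : En n × En n, G k p.swap := by
    intro k
    have := integral_prod_swap (μ := (volume : Measure (En n))) (ν := (volume : Measure (En n))) (G k)
    rw [Measure.volume_eq_prod, this]
  have e3 : ∫ p : En n × En n, pw (d ^ 2) (p.1 - p.2) ^ 4 * (gdiv a ρ p.1 * ρ p.2) = ∑ k, ∫ p, G k p := by
    rw [← Finset.sum_congr rfl (fun k _ => e1 k), ← integral_finsetSum _ (fun k _ => i1 k)]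
    congr 1; funext p
    rw [← Finset.mul_sum, ← Finset.sum_mul]
    rfl
  have iGs : ∀ k, Integrable (fun p : En n × En n => G k p.swap) := fun k => (iG k).swap
  have e4 : 2 * ∑ k, ∫ p, G k p = ∑ k, ∫ p : En n × En n, (G k p + G k p.swap) := by
    rw [Finset.mul_sum]
    apply Finset.sum_congr rfl; intro k _
    rw [integral_add (iG k) (iGs k), ← e2 k]; ring
  have iGG : ∀ k, Integrable (fun p : En n × En n => G k p + G k p.swap) := fun k => (iG k).add (iGs k)
  rw [e3, e4, ← integral_finsetSum _ (fun k _ => iGG k)]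
  congr 1; funext p
  rw [Finset.mul_sum, Finset.sum_mul]
  apply Finset.sum_congr rfl; intro k _
  simp only [G, F, Prod.fst_swap, Prod.snd_swap]
  rw [← pw_neg _ (p.2 - p.1), neg_sub]
  ring

lemma nonlin_pointwise {K R e : ℝ} (hK : 0 < K) (hR : 0 < R) (he : 0 < e) {a : En n → ℝ}
    (hw : IsWeight n K R e a) {d d0 : ℝ} (hd : 0 < d) (hdd : d ≤ d0) (x y : En n) :
    (if ‖x‖ ≤ R ∧ ‖y‖ ≤ R then 4 * (Dm e x y * pw (d0 ^ 2) (x - y) ^ 6) else 0)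
      - 4 * (K / R) * (‖x - y‖ ^ 4)⁻¹ ≤
    4 * pw (d ^ 2) (x - y) ^ 6 * (∑ k, (x k - y k) * (pd (eb k) a x - pd (eb k) a y)) := by
  have hs : 0 < d ^ 2 := by positivity
  have hs0 : 0 < d0 ^ 2 := by have := hd.trans_le hdd; positivity
  have hp := (pw_pos hs (x - y)).le
  split_ifs with h
  · have : ∑ k, (x k - y k) * (pd (eb k) a x - pd (eb k) a y) = Dm e x y := by
      simp only [Dm, hw.gradin x h.1, hw.gradin y h.2]
    rw [this]
    have h1 : pw (d0 ^ 2) (x - y) ≤ pw (d ^ 2) (x - y) := pw_anti hs (by gcongr) _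
    have h2 := (pw_pos hs0 (x - y)).le
    have h3 : pw (d0 ^ 2) (x - y) ^ 6 ≤ pw (d ^ 2) (x - y) ^ 6 := by gcongr
    have h4 := mul_le_mul_of_nonneg_left h3 (Dm_nonneg he x y)
    have h5 : 0 ≤ 4 * (K / R) * (‖x - y‖ ^ 4)⁻¹ := by positivity
    linarith
  · have h1 := semiconvex hw.sm hw.hess x y
    have h2 := mul_le_mul_of_nonneg_left h1 (by positivity : 0 ≤ 4 * pw (d ^ 2) (x - y) ^ 6)
    refine le_trans ?_ h2
    by_cases hxy : x - y = 0
    · simp [hxy]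
    have h3 := pw_le_norm_inv hs.le hxy
    have h4 : pw (d ^ 2) (x - y) ^ 6 ≤ (‖x - y‖⁻¹) ^ 6 := by gcongr
    have hz : 0 < ‖x - y‖ := norm_pos_iff.2 hxy
    have h5 : pw (d ^ 2) (x - y) ^ 6 * ‖x - y‖ ^ 2 ≤ (‖x - y‖ ^ 4)⁻¹ := by
      calc _ ≤ (‖x - y‖⁻¹) ^ 6 * ‖x - y‖ ^ 2 := by gcongr
        _ = _ := by field_simp
    have h6 := mul_le_mul_of_nonneg_left h5 (by positivity : 0 ≤ 4 * (K / R))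
    linarith

lemma Dm_meas {e : ℝ} (he : 0 < e) : Continuous (fun p : En n × En n => Dm e p.1 p.2) := by
  unfold Dm
  have cp := (sm_pw (n := n) he).cont
  have cx : ∀ k, Continuous (fun x : En n => x k) := fun k => (sm_coord k).cont
  apply continuous_finsetSum
  intro k _
  have h1 := (cx k).comp (continuous_fst (X := En n) (Y := En n))
  have h2 := (cx k).comp (continuous_snd (X := En n) (Y := En n))
  simp only [Function.comp_def] at *
  fun_prop

lemma abs_Dm_le {e : ℝ} (he : 0 < e) (x y : En n) : |Dm e x y| ≤ 2 * n * ‖x - y‖ := by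
  unfold Dm
  refine (Finset.abs_sum_le_sum_abs _ _).trans ?_
  have : ∀ k ∈ (Finset.univ : Finset (Fin n)), |(x k - y k) * (x k * pw e x - y k * pw e y)| ≤ 2 * ‖x - y‖ := by
    intro k _
    rw [abs_mul, mul_comm]
    have h1 : |x k - y k| ≤ ‖x - y‖ := abs_coord_le (x - y) k
    have h2 : |x k * pw e x - y k * pw e y| ≤ 2 := by
      refine (abs_sub _ _).trans ?_
      have := abs_coord_pw he x k
      have := abs_coord_pw he y k
      linarith
    gcongr
  refine (Finset.sum_le_sum this).trans (le_of_eq ?_)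
  simp; ring

/-- The regularised nonlinear density. -/
def Qd (R e d : ℝ) (x y : En n) : ℝ :=
  if ‖x‖ ≤ R ∧ ‖y‖ ≤ R then 4 * (Dm e x y * pw (d ^ 2) (x - y) ^ 6) else 0

lemma Qd_integrable {R e d : ℝ} (he : 0 < e) (hd : 0 < d) {ρ : En n → ℝ} (hi : Integrable ρ) :
    Integrable (fun p : En n × En n => Qd R e d p.1 p.2 * (ρ p.1 * ρ p.2)) := by
  have hs : 0 < d ^ 2 := by positivity
  have cp : Continuous (fun p : En n × En n => pw (d ^ 2) (p.1 - p.2)) := (sm_pw hs).cont.comp (by fun_prop)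
  apply (hi.mul_prod hi).bdd_mul (c := 4 * (2 * n * d⁻¹ ^ 5))
  · have : Measurable (fun p : En n × En n => Qd R e d p.1 p.2) := by
      unfold Qd
      apply Measurable.ite
      · exact (isClosed_le (by fun_prop) (by fun_prop) |>.inter
          (isClosed_le (by fun_prop) (by fun_prop)) : IsClosed ({p : En n × En n | ‖p.1‖ ≤ R} ∩ {p | ‖p.2‖ ≤ R})).measurableSet
      · have := Dm_meas (n := n) he
        exact (by fun_prop : Continuous _).measurable
      · fun_prop
    exact this.aestronglyMeasurable
  · filter_upwards with p
    unfold Qd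
    split_ifs with h
    · rw [norm_mul, norm_mul, show ‖(4:ℝ)‖ = 4 by norm_num, norm_pow, Real.norm_of_nonneg (pw_pos hs _).le]
      have hp := (pw_pos hs (p.1 - p.2)).le
      have h1 := abs_Dm_le he p.1 p.2
      have h2 := pw_le_inv hd (p.1 - p.2)
      have h3 : ‖p.1 - p.2‖ * pw (d ^ 2) (p.1 - p.2) ≤ 1 := by
        by_cases hz : p.1 - p.2 = 0
        · simp [hz]
        · have h4 := pw_le_norm_inv hs.le hz
          have hz' := norm_pos_iff.2 hz
          calc _ ≤ ‖p.1 - p.2‖ * ‖p.1 - p.2‖⁻¹ := by gcongr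
            _ = 1 := mul_inv_cancel₀ hz'.ne'
      refine mul_le_mul_of_nonneg_left ?_ (by norm_num)
      calc ‖Dm e p.1 p.2‖ * pw (d ^ 2) (p.1 - p.2) ^ 6
          ≤ (2 * n * ‖p.1 - p.2‖) * pw (d ^ 2) (p.1 - p.2) ^ 6 := by gcongr; exact h1
        _ = (2 * n) * (‖p.1 - p.2‖ * pw (d ^ 2) (p.1 - p.2)) * pw (d ^ 2) (p.1 - p.2) ^ 5 := by ring
        _ ≤ (2 * n) * 1 * d⁻¹ ^ 5 := by gcongr
        _ = _ := by ring
    · simp; positivity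

lemma nonlin (hn : 5 ≤ n) {K R e : ℝ} (hK : 0 < K) (hR : 0 < R) (he : 0 < e) {a : En n → ℝ}
    (hw : IsWeight n K R e a) {d0 : ℝ} (hd0 : 0 < d0) {ρ : En n → ℝ} (hρ : Sm ρ) (hi : Integrable ρ)
    (h0 : ∀ x, 0 ≤ ρ x) {B : ℝ} (hB : ∀ x, |ρ x| ≤ B) :
    (∫ p : En n × En n, Qd R e d0 p.1 p.2 * (ρ p.1 * ρ p.2))
      - 4 * (K / R) * ∫ p : En n × En n, (‖p.1 - p.2‖ ^ 4)⁻¹ * (ρ p.1 * ρ p.2)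
    ≤ 2 * ∫ x, (∫ y, (‖x - y‖ ^ 4)⁻¹ * ρ y) * gdiv a ρ x := by
  have sF : ∀ k : Fin n, Sm (fun x => ρ x * pd (eb k) a x) := fun k => hρ.mul (hw.sm.pd _)
  have cF : ∀ k : Fin n, HasCompactSupport (fun x => ρ x * pd (eb k) a x) := fun k => (hw.cs.pd _).mul_left
  have ig : Integrable (gdiv a ρ) := by
    apply integrable_finsetSum
    intro k _
    exact ((sF k).pd _).cont.integrable_of_hasCompactSupport ((cF k).pd _)
  have I1 := kernel_integrable hn (le_refl 4) ig hi hB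
  have I2 := kernel_integrable hn (le_refl 4) hi hi hB
  have e1 : ∫ x, (∫ y, (‖x - y‖ ^ 4)⁻¹ * ρ y) * gdiv a ρ x
      = ∫ p : En n × En n, (‖p.1 - p.2‖ ^ 4)⁻¹ * (gdiv a ρ p.1 * ρ p.2) := by
    rw [Measure.volume_eq_prod, integral_prod _ I1]
    congr 1; funext x
    rw [← integral_mul_const]
    congr 1; funext y; ring
  rw [e1]
  let d : ℕ → ℝ := fun m => d0 / (m + 1)
  have hdpos : ∀ m, 0 < d m := fun m => by positivity
  have hdle : ∀ m, d m ≤ d0 := fun m => div_le_self hd0.le (by linarith [(Nat.cast_nonneg m : (0:ℝ) ≤ m)])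
  have hdt : Filter.Tendsto d Filter.atTop (nhds 0) := by
    have := (tendsto_one_div_add_atTop_nhds_zero_nat (𝕜 := ℝ)).const_mul d0
    simpa [d, div_eq_mul_inv] using this
  have hcp : ∀ m, Continuous (fun p : En n × En n => pw (d m ^ 2) (p.1 - p.2)) := fun m =>
    (sm_pw (pow_pos (hdpos m) 2)).cont.comp (by fun_prop)
  have lim : Filter.Tendsto (fun m => ∫ p : En n × En n, pw (d m ^ 2) (p.1 - p.2) ^ 4 * (gdiv a ρ p.1 * ρ p.2))
      Filter.atTop (nhds (∫ p : En n × En n, (‖p.1 - p.2‖ ^ 4)⁻¹ * (gdiv a ρ p.1 * ρ p.2))) := by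
    apply tendsto_integral_of_dominated_convergence (fun p : En n × En n => ‖(‖p.1 - p.2‖ ^ 4)⁻¹ * (gdiv a ρ p.1 * ρ p.2)‖)
    · intro m
      exact ((hcp m).pow 4).aestronglyMeasurable.mul (ig.mul_prod hi).aestronglyMeasurable
    · exact I1.norm
    · intro m
      filter_upwards [ae_ne hn] with p hp
      rw [norm_mul (pw (d m ^ 2) (p.1 - p.2) ^ 4), norm_mul ((‖p.1 - p.2‖ ^ 4)⁻¹)]
      apply mul_le_mul_of_nonneg_right _ (norm_nonneg _)
      have h1 := pw_le_norm_inv (pow_pos (hdpos m) 2).le (sub_ne_zero.2 hp)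
      have h2 := (pw_pos (pow_pos (hdpos m) 2) (p.1 - p.2)).le
      rw [norm_pow, Real.norm_of_nonneg h2, norm_inv, norm_pow, norm_norm, ← inv_pow]
      gcongr
    · filter_upwards [ae_ne hn] with p hp
      apply Filter.Tendsto.mul_const
      have hz : 0 < ‖p.1 - p.2‖ := norm_pos_iff.2 (sub_ne_zero.2 hp)
      rw [← inv_pow]
      apply Filter.Tendsto.pow
      unfold pw
      apply Filter.Tendsto.inv₀ _ hz.ne'
      have : Filter.Tendsto (fun m => Real.sqrt (‖p.1 - p.2‖ ^ 2 + d m ^ 2)) Filter.atTop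
          (nhds (Real.sqrt (‖p.1 - p.2‖ ^ 2 + 0 ^ 2))) :=
        (Real.continuous_sqrt.tendsto _).comp ((hdt.pow 2).const_add _)
      simpa [Real.sqrt_sq hz.le] using this
  refine ge_of_tendsto (lim.const_mul 2) ?_
  filter_upwards with m
  have hs : 0 < d m ^ 2 := pow_pos (hdpos m) 2
  rw [reg_identity hw.sm hw.cs hρ hi (hdpos m), ← integral_const_mul, ← integral_sub (Qd_integrable he hd0 hi) (I2.const_mul _)]
  apply integral_mono ((Qd_integrable he hd0 hi).sub (I2.const_mul _))
  · have hG : ∀ k : Fin n, Integrable (fun x => ρ x * pd (eb k) a x) := fun k =>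
      (sF k).cont.integrable_of_hasCompactSupport (cF k)
    have i1 := integrable_finsetSum Finset.univ (fun k (_ : k ∈ Finset.univ) =>
      ((integrable_reg (hdpos m) (hG k) hi k).sub (integrable_reg (hdpos m) hi (hG k) k)))
    refine i1.congr ?_
    filter_upwards with p
    rw [Finset.mul_sum, Finset.sum_mul]
    apply Finset.sum_congr rfl; intro k _
    simp only [Pi.sub_apply]
    ring
  · intro p
    have h1 := nonlin_pointwise hK hR he hw (hdpos m) (hdle m) p.1 p.2
    have h2 := mul_le_mul_of_nonneg_right h1 (mul_nonneg (h0 p.1) (h0 p.2))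
    refine le_trans (le_of_eq ?_) h2
    simp only [Qd]
    simp only [Pi.sub_apply]; ring

end Nonlin2


section FixedTime
variable {n : ℕ}

/-- The Morawetz action. -/
def Mom (a v w : En n → ℝ) : ℝ :=
  ∑ k, 2 * ∫ x, pd (eb k) a x * (v x * pd (eb k) w x - w x * pd (eb k) v x)

/-- The derivative of the Morawetz action. -/
def Mder (a v w vt wt : En n → ℝ) : ℝ :=
  ∑ k, 2 * ∫ x, (vt x * (2 * (pd (eb k) a x * pd (eb k) w x) + pd (eb k) (pd (eb k) a) x * w x)
    - wt x * (2 * (pd (eb k) a x * pd (eb k) v x) + pd (eb k) (pd (eb k) a) x * v x))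

/-- The density. -/
def rho (v w : En n → ℝ) (x : En n) : ℝ := v x ^ 2 + w x ^ 2

/-- The potential. -/
def pot (ρ : En n → ℝ) (x : En n) : ℝ := ∫ y, (‖x - y‖ ^ 4)⁻¹ * ρ y

lemma rho_sm {v w : En n → ℝ} (hv : Sm v) (hw : Sm w) : Sm (rho v w) := (hv.pow 2).add (hw.pow 2)

lemma rho_int {v w : En n → ℝ} (hv : Nice v) (hw : Nice w) : Integrable (rho v w) := hv.isq.add hw.isq

lemma rho_nonneg (v w : En n → ℝ) (x : En n) : 0 ≤ rho v w x := by unfold rho; positivity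

lemma rho_bdd {v w : En n → ℝ} (hv : Nice v) (hw : Nice w) : ∃ B, ∀ x, |rho v w x| ≤ B := by
  obtain ⟨B1, h1⟩ := hv.bdd
  obtain ⟨B2, h2⟩ := hw.bdd
  refine ⟨B1 ^ 2 + B2 ^ 2, fun x => ?_⟩
  rw [abs_of_nonneg (rho_nonneg v w x)]
  exact add_le_add (sq_le_sq' (by linarith [neg_abs_le (v x), h1 x]) ((le_abs_self _).trans (h1 x)))
    (sq_le_sq' (by linarith [neg_abs_le (w x), h2 x]) ((le_abs_self _).trans (h2 x)))

lemma pot_mul_int (hn : 5 ≤ n) {ρ F : En n → ℝ} (hi : Integrable ρ) {B : ℝ} (hB : ∀ x, |ρ x| ≤ B)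
    (hF : Continuous F) (hc : HasCompactSupport F) : Integrable (fun x => pot ρ x * F x) := by
  have := (kernel_integrable hn (le_refl 4) (hF.integrable_of_hasCompactSupport hc) hi hB).integral_prod_left
  refine this.congr ?_
  filter_upwards with x
  unfold pot
  rw [← integral_mul_const]
  congr 1; funext y; ring

lemma Mder_eq (hn : 5 ≤ n) {a v w vt wt : En n → ℝ} (ha : Sm a) (hc : HasCompactSupport a)
    (hv : Nice v) (hw : Nice w)
    (hvt : ∀ x, vt x = - (∑ j, pd (eb j) (pd (eb j) w) x) + pot (rho v w) x * w x)
    (hwt : ∀ x, wt x = (∑ j, pd (eb j) (pd (eb j) v) x) - pot (rho v w) x * v x) :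
    Mder a v w vt wt =
      (∑ k, ∑ j, ∫ x, (4 * (pd (eb j) (pd (eb k) a) x * (pd (eb j) v x * pd (eb k) v x))
        - pd (eb j) (pd (eb j) (pd (eb k) (pd (eb k) a))) x * v x ^ 2))
      + (∑ k, ∑ j, ∫ x, (4 * (pd (eb j) (pd (eb k) a) x * (pd (eb j) w x * pd (eb k) w x))
        - pd (eb j) (pd (eb j) (pd (eb k) (pd (eb k) a))) x * w x ^ 2))
      + 2 * ∫ x, pot (rho v w) x * gdiv a (rho v w) x := by
  obtain ⟨B, hB⟩ := rho_bdd hv hw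
  have hi := rho_int hv hw
  have srho := rho_sm hv.sm hw.sm
  have sF : ∀ k : Fin n, Sm (fun x => rho v w x * pd (eb k) a x) := fun k => srho.mul (ha.pd _)
  have cF : ∀ k : Fin n, HasCompactSupport (fun x => rho v w x * pd (eb k) a x) := fun k => (hc.pd _).mul_left
  have iN : ∀ k, Integrable (fun x => pot (rho v w) x * pd (eb k) (fun x => rho v w x * pd (eb k) a x) x) :=
    fun k => pot_mul_int hn hi hB ((sF k).pd _).cont ((cF k).pd _)
  let L : (En n → ℝ) → Fin n → Fin n → En n → ℝ := fun f k j x =>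
    -4 * (pd (eb j) (pd (eb j) f) x * (pd (eb k) a x * pd (eb k) f x))
      - 2 * (pd (eb j) (pd (eb j) f) x * (pd (eb k) (pd (eb k) a) x * f x))
  have iL : ∀ f, Sm f → ∀ k j, Integrable (L f k j) := by
    intro f hf k j
    have c1 := ((hf.pd (eb j)).pd (eb j)).cont
    have c2 := (ha.pd (eb k)).cont
    have c3 := ((ha.pd (eb k)).pd (eb k)).cont
    have c4 := (hf.pd (eb k)).cont
    have c5 := hf.cont
    apply (by fun_prop : Continuous (L f k j)).integrable_of_hasCompactSupport
    have h1 := hc.pd (eb k)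
    have h2 := h1.pd (eb k)
    apply HasCompactSupport.sub
    · exact ((h1.mul_right).mul_left).mul_left
    · exact ((h2.mul_right).mul_left).mul_left
  have e1 : ∀ f, Sm f → ∀ k j, ∫ x, (4 * (pd (eb j) (pd (eb k) a) x * (pd (eb j) f x * pd (eb k) f x))
        - pd (eb j) (pd (eb j) (pd (eb k) (pd (eb k) a))) x * f x ^ 2) = ∫ x, L f k j x :=
    fun f hf k j => (linear_morawetz_jk hf ha hc j k).symm
  simp only [e1 v hv.sm, e1 w hw.sm]
  have e2 : ∫ x, pot (rho v w) x * gdiv a (rho v w) x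
     = ∑ k, ∫ x, pot (rho v w) x * pd (eb k) (fun x => rho v w x * pd (eb k) a x) x := by
    rw [← integral_finsetSum _ (fun k _ => iN k)]
    congr 1; funext x; rw [gdiv, Finset.mul_sum]
  rw [e2, Mder, Finset.mul_sum, ← Finset.sum_add_distrib, ← Finset.sum_add_distrib]
  apply Finset.sum_congr rfl
  intro k _
  have iLL : Integrable (fun x => (∑ j, L v k j x) + ∑ j, L w k j x) :=
    (integrable_finsetSum _ (fun j _ => iL v hv.sm k j)).add (integrable_finsetSum _ (fun j _ => iL w hw.sm k j))
  rw [← integral_finsetSum _ (fun j _ => iL v hv.sm k j), ← integral_finsetSum _ (fun j _ => iL w hw.sm k j),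
    ← integral_const_mul, ← integral_const_mul,
    ← integral_add (integrable_finsetSum _ (fun j _ => iL v hv.sm k j)) (integrable_finsetSum _ (fun j _ => iL w hw.sm k j)),
    ← integral_add iLL ((iN k).const_mul 2)]
  congr 1; funext x
  have hpd : pd (eb k) (fun x => rho v w x * pd (eb k) a x) x
      = 2 * (v x * pd (eb k) v x + w x * pd (eb k) w x) * pd (eb k) a x + rho v w x * pd (eb k) (pd (eb k) a) x := by
    have sv2 : Sm (fun x => v x ^ 2) := hv.sm.pow 2
    have sw2 : Sm (fun x => w x ^ 2) := hw.sm.pow 2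
    have : pd (eb k) (rho v w) x = 2 * (v x * pd (eb k) v x + w x * pd (eb k) w x) := by
      have h := pd_add (sv2.at x) (sw2.at x) (eb k)
      rw [pd_pow (hv.sm.at x) 1, pd_pow (hw.sm.at x) 1] at h
      have h' : pd (eb k) (rho v w) x = pd (eb k) (fun x => v x ^ 2 + w x ^ 2) x := rfl
      rw [h', h]
      simp; ring
    rw [pd_mul (srho.at x) ((ha.pd _).at x), this]
  rw [hpd, hvt, hwt]
  have hLs : ∀ f : En n → ℝ, ∑ j, L f k j x = - (∑ j, pd (eb j) (pd (eb j) f) x) *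
      (4 * (pd (eb k) a x * pd (eb k) f x) + 2 * (pd (eb k) (pd (eb k) a) x * f x)) := by
    intro f
    rw [neg_mul, Finset.sum_mul, ← Finset.sum_neg_distrib]
    apply Finset.sum_congr rfl; intro j _
    simp only [L]; ring
  rw [hLs, hLs, rho]
  ring

/-- Linear part of the density. -/
def Pd (R e : ℝ) (x : En n) : ℝ := if ‖x‖ ≤ R then 8 * pw e x ^ 3 else 0

lemma Pd_int {R e : ℝ} (he : 0 < e) {ρ : En n → ℝ} (hi : Integrable ρ) :
    Integrable (fun x => Pd R e x * ρ x) := by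
  have hs : 0 < Real.sqrt e := Real.sqrt_pos.2 he
  have he2 : e = (Real.sqrt e) ^ 2 := (Real.sq_sqrt he.le).symm
  have cp : Continuous (pw (n := n) e) := (sm_pw he).cont
  apply hi.bdd_mul (c := 8 * (Real.sqrt e)⁻¹ ^ 3)
  · have : Measurable (fun p : En n => Pd R e p) := by
      unfold Pd
      apply Measurable.ite
      · exact (isClosed_le (by fun_prop) (by fun_prop)).measurableSet
      · exact ((cp.pow 3).measurable).const_mul 8
      · exact measurable_const
    exact this.aestronglyMeasurable
  · filter_upwards with x
    unfold Pd
    split_ifs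
    · rw [norm_mul, norm_pow, Real.norm_of_nonneg (pw_pos he _).le, show ‖(8:ℝ)‖ = 8 by norm_num]
      have h1 := (pw_pos he x).le
      have h2 : pw e x ≤ (Real.sqrt e)⁻¹ := by
        have := pw_le_inv hs x
        rwa [← he2] at this
      gcongr
    · simp

lemma bilap_lower {K R e : ℝ} (hK : 0 < K) (hR : 0 < R) {a : En n → ℝ} (hw : IsWeight n K R e a) (x : En n) :
    Pd R e x - 10 * K / R * pw (R ^ 2) x ^ 2 ≤
      - ∑ j, ∑ k, pd (eb j) (pd (eb j) (pd (eb k) (pd (eb k) a))) x := by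
  have h0 : 0 ≤ 10 * K / R * pw (R ^ 2) x ^ 2 := by positivity
  unfold Pd
  split_ifs with h
  · linarith [hw.bilap_in x h]
  · have hb := hw.bilap x
    split_ifs at hb with h3
    · have h1 := ball_le_pw hR x h3
      have h2 : K / R ^ 3 ≤ 10 * K / R * pw (R ^ 2) x ^ 2 := by
        calc K / R ^ 3 = K / R ^ 3 * 1 := by ring
          _ ≤ K / R ^ 3 * (10 * R ^ 2 * pw (R ^ 2) x ^ 2) := by gcongr
          _ = _ := by field_simp
      linarith
    · linarith

lemma pwR_int {R : ℝ} (hR : 0 < R) {ρ : En n → ℝ} (hi : Integrable ρ) :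
    Integrable (fun x => ρ x * pw (R ^ 2) x ^ 2) := by
  have hs : 0 < R ^ 2 := by positivity
  have cp : Continuous (pw (n := n) (R ^ 2)) := (sm_pw hs).cont
  apply hi.mul_bdd (c := R⁻¹ ^ 2) (by fun_prop)
  filter_upwards with x
  rw [norm_pow, Real.norm_of_nonneg (pw_pos hs x).le]
  have := (pw_pos hs x).le
  gcongr
  exact pw_le_inv hR x

lemma linear_lower (hn : 5 ≤ n) {K R e : ℝ} (hK : 0 < K) (hR : 0 < R) (he : 0 < e) {a : En n → ℝ}
    (hw : IsWeight n K R e a) {f : En n → ℝ} (hf : Nice f) :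
    (∫ x, Pd R e x * f x ^ 2) - 9 * K / R * ∫ x, ∑ j, pd (eb j) f x ^ 2 ≤
    ∑ k, ∑ j, ∫ x, (4 * (pd (eb j) (pd (eb k) a) x * (pd (eb j) f x * pd (eb k) f x))
        - pd (eb j) (pd (eb j) (pd (eb k) (pd (eb k) a))) x * f x ^ 2) := by
  have iL : ∀ k j : Fin n, Integrable (fun x => (4 * (pd (eb j) (pd (eb k) a) x * (pd (eb j) f x * pd (eb k) f x))
        - pd (eb j) (pd (eb j) (pd (eb k) (pd (eb k) a))) x * f x ^ 2)) := by
    intro k j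
    have ha := hw.sm
    have c1 := ((ha.pd (eb k)).pd (eb j)).cont
    have c2 := ((((ha.pd (eb k)).pd (eb k)).pd (eb j)).pd (eb j)).cont
    have c3 := (hf.sm.pd (eb j)).cont
    have c4 := (hf.sm.pd (eb k)).cont
    have c5 := hf.sm.cont
    apply Continuous.integrable_of_hasCompactSupport (by fun_prop)
    apply HasCompactSupport.sub
    · exact (((hw.cs.pd _).pd _).mul_right).mul_left
    · exact ((((hw.cs.pd _).pd _).pd _).pd _).mul_right
  have ig : Integrable (fun x => ∑ j, pd (eb j) f x ^ 2) := integrable_finsetSum _ fun j _ => hf.igrad j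
  have ip := Pd_int (R := R) he hf.isq
  have iq := pwR_int hR hf.isq
  have hh := hardy hn hf hR
  have e1 : ∑ k, ∑ j, ∫ x, (4 * (pd (eb j) (pd (eb k) a) x * (pd (eb j) f x * pd (eb k) f x))
        - pd (eb j) (pd (eb j) (pd (eb k) (pd (eb k) a))) x * f x ^ 2)
      = ∫ x, ∑ k, ∑ j, (4 * (pd (eb j) (pd (eb k) a) x * (pd (eb j) f x * pd (eb k) f x))
        - pd (eb j) (pd (eb j) (pd (eb k) (pd (eb k) a))) x * f x ^ 2) := by
    rw [integral_finsetSum _ (fun k _ => integrable_finsetSum _ fun j _ => iL k j)]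
    apply Finset.sum_congr rfl; intro k _
    rw [integral_finsetSum _ fun j _ => iL k j]
  rw [e1]
  have e2 : ∫ x, (Pd R e x * f x ^ 2 - 10 * K / R * (f x ^ 2 * pw (R ^ 2) x ^ 2) - 4 * K / R * ∑ j, pd (eb j) f x ^ 2)
      ≤ ∫ x, ∑ k, ∑ j, (4 * (pd (eb j) (pd (eb k) a) x * (pd (eb j) f x * pd (eb k) f x))
        - pd (eb j) (pd (eb j) (pd (eb k) (pd (eb k) a))) x * f x ^ 2) := by
    apply integral_mono ((ip.sub (iq.const_mul _)).sub (ig.const_mul _))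
      (integrable_finsetSum _ fun k _ => integrable_finsetSum _ fun j _ => iL k j)
    intro x
    have h1 := mul_le_mul_of_nonneg_right (bilap_lower hK hR hw x) (sq_nonneg (f x))
    have h2 := hw.hess x (fun j => pd (eb j) f x)
    have h3 : ∑ k, ∑ j, (4 * (pd (eb j) (pd (eb k) a) x * (pd (eb j) f x * pd (eb k) f x))
        - pd (eb j) (pd (eb j) (pd (eb k) (pd (eb k) a))) x * f x ^ 2)
      = 4 * (∑ j, ∑ k, pd (eb j) (pd (eb k) a) x * (pd (eb j) f x * pd (eb k) f x))
        + (- ∑ j, ∑ k, pd (eb j) (pd (eb j) (pd (eb k) (pd (eb k) a))) x) * f x ^ 2 := by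
      rw [Finset.sum_comm, neg_mul, ← sub_eq_add_neg, Finset.mul_sum, Finset.sum_mul, ← Finset.sum_sub_distrib]
      apply Finset.sum_congr rfl; intro j _
      rw [Finset.mul_sum, Finset.sum_mul, ← Finset.sum_sub_distrib]
    show Pd R e x * f x ^ 2 - 10 * K / R * (f x ^ 2 * pw (R ^ 2) x ^ 2) - 4 * K / R * ∑ j, pd (eb j) f x ^ 2 ≤ _
    simp only
    rw [h3]
    have h4 : 4 * K / R * ∑ j, pd (eb j) f x ^ 2 = 4 * (K / R * ∑ j, pd (eb j) f x ^ 2) := by ring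
    rw [h4]
    nlinarith
  have e3 : ∫ x, (Pd R e x * f x ^ 2 - 10 * K / R * (f x ^ 2 * pw (R ^ 2) x ^ 2) - 4 * K / R * ∑ j, pd (eb j) f x ^ 2)
     = (∫ x, Pd R e x * f x ^ 2) - 10 * K / R * (∫ x, f x ^ 2 * pw (R ^ 2) x ^ 2) - 4 * K / R * ∫ x, ∑ j, pd (eb j) f x ^ 2 := by
    have ipq : Integrable (fun x => Pd R e x * f x ^ 2 - 10 * K / R * (f x ^ 2 * pw (R ^ 2) x ^ 2)) :=
      ip.sub (iq.const_mul _)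
    rw [integral_sub ipq (ig.const_mul _), integral_sub ip (iq.const_mul _), integral_const_mul, integral_const_mul]
  rw [e3] at e2
  refine le_trans ?_ e2
  have h5 := mul_le_mul_of_nonneg_left hh (by positivity : 0 ≤ 5 * K / R)
  have h6 : 9 * K / R * ∫ x, ∑ j, pd (eb j) f x ^ 2 = 5 * K / R * (∫ x, ∑ j, pd (eb j) f x ^ 2) + 4 * K / R * (∫ x, ∑ j, pd (eb j) f x ^ 2) := by ring
  have h7 : 5 * K / R * (2 * ∫ x, f x ^ 2 * pw (R ^ 2) x ^ 2) = 10 * K / R * (∫ x, f x ^ 2 * pw (R ^ 2) x ^ 2) := by ring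
  linarith

/-- Kinetic energy. -/
def kin (v w : En n → ℝ) : ℝ := (∫ x, ∑ j, pd (eb j) v x ^ 2) + ∫ x, ∑ j, pd (eb j) w x ^ 2

/-- Potential energy. -/
def pote (v w : En n → ℝ) : ℝ := ∫ p : En n × En n, (‖p.1 - p.2‖ ^ 4)⁻¹ * (rho v w p.1 * rho v w p.2)

/-- The coercive quantity. -/
def Phi (R e d : ℝ) (ρ : En n → ℝ) : ℝ :=
  (∫ x, Pd R e x * ρ x) + ∫ p : En n × En n, Qd R e d p.1 p.2 * (ρ p.1 * ρ p.2)

lemma Mder_lower (hn : 5 ≤ n) {K R e d : ℝ} (hK : 0 < K) (hR : 0 < R) (he : 0 < e) (hd : 0 < d) {a : En n → ℝ}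
    (hwt : IsWeight n K R e a) {v w vt wt : En n → ℝ} (hv : Nice v) (hw : Nice w)
    (hvt' : ∀ x, vt x = - (∑ j, pd (eb j) (pd (eb j) w) x) + pot (rho v w) x * w x)
    (hwt' : ∀ x, wt x = (∑ j, pd (eb j) (pd (eb j) v) x) - pot (rho v w) x * v x) :
    Phi R e d (rho v w) - K / R * (9 * kin v w + 4 * pote v w) ≤ Mder a v w vt wt := by
  rw [Mder_eq hn hwt.sm hwt.cs hv hw hvt' hwt']
  obtain ⟨B, hB⟩ := rho_bdd hv hw
  have h1 := linear_lower hn hK hR he hwt hv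
  have h2 := linear_lower hn hK hR he hwt hw
  have h3 := nonlin hn hK hR he hwt hd (rho_sm hv.sm hw.sm) (rho_int hv hw) (rho_nonneg v w) hB
  have h4 : ∫ x, Pd R e x * rho v w x = (∫ x, Pd R e x * v x ^ 2) + ∫ x, Pd R e x * w x ^ 2 := by
    rw [← integral_add (Pd_int he hv.isq) (Pd_int he hw.isq)]
    congr 1; funext x; unfold rho; ring
  unfold Phi
  rw [h4]
  have h5 : K / R * (9 * kin v w + 4 * pote v w) = 9 * K / R * (∫ x, ∑ j, pd (eb j) v x ^ 2)
    + 9 * K / R * (∫ x, ∑ j, pd (eb j) w x ^ 2) + 4 * (K / R) * pote v w := by unfold kin; ring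
  rw [h5]
  unfold pot pote at *
  linarith

lemma Mom_bound (hn : 5 ≤ n) {K R e : ℝ} (hK : 0 < K) (hR : 0 < R) {a : En n → ℝ}
    (hwt : IsWeight n K R e a) {v w : En n → ℝ} (hv : Nice v) (hw : Nice w) :
    |Mom a v w| ≤ K * R * (5 * n + 1) * kin v w := by
  have hs : 0 < R ^ 2 := by positivity
  have ia : ∀ k : Fin n, Integrable (fun x => 10 * R * (rho v w x * pw (R ^ 2) x ^ 2) + R * (pd (eb k) v x ^ 2 + pd (eb k) w x ^ 2)) :=
    fun k => ((pwR_int hR (rho_int hv hw)).const_mul _).add (((hv.igrad k).add (hw.igrad k)).const_mul _)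
  have key : ∀ k : Fin n, |2 * ∫ x, pd (eb k) a x * (v x * pd (eb k) w x - w x * pd (eb k) v x)| ≤
      K * ∫ x, (10 * R * (rho v w x * pw (R ^ 2) x ^ 2) + R * (pd (eb k) v x ^ 2 + pd (eb k) w x ^ 2)) := by
    intro k
    rw [← integral_const_mul, ← integral_const_mul, ← Real.norm_eq_abs]
    apply norm_integral_le_of_norm_le ((ia k).const_mul _)
    filter_upwards with x
    rw [Real.norm_eq_abs, abs_mul, abs_mul, abs_two]
    set α := pd (eb k) v x
    set β := pd (eb k) w x
    have hp : 0 ≤ 10 * R * (rho v w x * pw (R ^ 2) x ^ 2) + R * (α ^ 2 + β ^ 2) := by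
      have := rho_nonneg v w x; positivity
    by_cases hx : 3 * R < ‖x‖
    · rw [hwt.out x k hx]; simp; positivity
    · have h1 := hwt.grad x k
      have h2 := ball_le_pw hR x (not_lt.1 hx)
      have h3 : 2 * |v x * β - w x * α| ≤ R⁻¹ * rho v w x + R * (α ^ 2 + β ^ 2) := by
        have : 2 * |v x * β - w x * α| = R⁻¹ * (2 * R * |v x * β - w x * α|) := by field_simp
        rw [this]
        have h4 : R⁻¹ * rho v w x + R * (α ^ 2 + β ^ 2) = R⁻¹ * (rho v w x + R ^ 2 * (α ^ 2 + β ^ 2)) := by field_simp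
        rw [h4]
        apply mul_le_mul_of_nonneg_left _ (by positivity)
        have h5 : 2 * R * |v x * β - w x * α| = |2 * R * (v x * β - w x * α)| := by
          rw [abs_mul, abs_of_pos (by positivity : 0 < 2 * R)]
        rw [h5, abs_le]; unfold rho
        constructor <;> nlinarith [sq_nonneg (v x - R * β), sq_nonneg (v x + R * β), sq_nonneg (w x - R * α), sq_nonneg (w x + R * α)]
      have h6 : R⁻¹ * rho v w x ≤ 10 * R * (rho v w x * pw (R ^ 2) x ^ 2) := by
        have h0 := rho_nonneg v w x
        calc R⁻¹ * rho v w x = R⁻¹ * rho v w x * 1 := by ring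
          _ ≤ R⁻¹ * rho v w x * (10 * R ^ 2 * pw (R ^ 2) x ^ 2) := by gcongr
          _ = _ := by field_simp
      calc 2 * (|pd (eb k) a x| * |v x * β - w x * α|) = |pd (eb k) a x| * (2 * |v x * β - w x * α|) := by ring
        _ ≤ K * (10 * R * (rho v w x * pw (R ^ 2) x ^ 2) + R * (α ^ 2 + β ^ 2)) := by
          gcongr; linarith
  have hsum : |Mom a v w| ≤ ∑ k : Fin n, K * ∫ x, (10 * R * (rho v w x * pw (R ^ 2) x ^ 2) + R * (pd (eb k) v x ^ 2 + pd (eb k) w x ^ 2)) :=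
    (Finset.abs_sum_le_sum_abs _ _).trans (Finset.sum_le_sum fun k _ => key k)
  refine hsum.trans ?_
  have hr : ∫ x, rho v w x * pw (R ^ 2) x ^ 2 = (∫ x, v x ^ 2 * pw (R ^ 2) x ^ 2) + ∫ x, w x ^ 2 * pw (R ^ 2) x ^ 2 := by
    rw [← integral_add (pwR_int hR hv.isq) (pwR_int hR hw.isq)]
    congr 1; funext x; unfold rho; ring
  have h1 := hardy hn hv hR
  have h2 := hardy hn hw hR
  have h3 : 2 * ∫ x, rho v w x * pw (R ^ 2) x ^ 2 ≤ kin v w := by rw [hr]; unfold kin; linarith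
  have h4 : ∀ k : Fin n, ∫ x, (10 * R * (rho v w x * pw (R ^ 2) x ^ 2) + R * (pd (eb k) v x ^ 2 + pd (eb k) w x ^ 2))
      = 10 * R * (∫ x, rho v w x * pw (R ^ 2) x ^ 2) + R * ((∫ x, pd (eb k) v x ^ 2) + ∫ x, pd (eb k) w x ^ 2) := by
    intro k
    have i2 : Integrable (fun x => pd (eb k) v x ^ 2 + pd (eb k) w x ^ 2) := (hv.igrad k).add (hw.igrad k)
    rw [integral_add ((pwR_int hR (rho_int hv hw)).const_mul _) (i2.const_mul _),
      integral_const_mul, integral_const_mul, integral_add (hv.igrad k) (hw.igrad k)]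
  simp only [h4]
  rw [← Finset.mul_sum, Finset.sum_add_distrib, ← Finset.mul_sum, ← Finset.mul_sum, Finset.sum_add_distrib,
    ← integral_finsetSum _ (fun k _ => hv.igrad k), ← integral_finsetSum _ (fun k _ => hw.igrad k)]
  simp only [Finset.sum_const, Finset.card_univ, Fintype.card_fin, nsmul_eq_mul]
  have h5 : K * (10 * R * ((n:ℝ) * ∫ x, rho v w x * pw (R ^ 2) x ^ 2) + R * ((∫ x, ∑ j, pd (eb j) v x ^ 2) + ∫ x, ∑ j, pd (eb j) w x ^ 2))
     = K * R * (5 * n * (2 * ∫ x, rho v w x * pw (R ^ 2) x ^ 2) + kin v w) := by unfold kin; ring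
  rw [h5]
  calc K * R * (5 * n * (2 * ∫ x, rho v w x * pw (R ^ 2) x ^ 2) + kin v w) ≤ K * R * (5 * n * kin v w + kin v w) := by gcongr
    _ = _ := by ring

end FixedTime


section TimeDer
variable {n : ℕ}

lemma hasDerivAt_time {H : ℝ × En n → ℝ} (hH : Sm H) (t : ℝ) (x : En n) :
    HasDerivAt (fun s => H (s, x)) (pd ((1:ℝ), (0 : En n)) H (t, x)) t := by
  have h1 : HasDerivAt (fun s : ℝ => (s, x)) ((1:ℝ), (0 : En n)) t :=
    (hasDerivAt_id t).prodMk (hasDerivAt_const t x)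
  exact (hH.at (t, x)).hasFDerivAt.comp_hasDerivAt t h1

lemma diff_int {H : ℝ × En n → ℝ} (hH : Sm H) {b : En n → ℝ} (hb : Continuous b)
    (hc : HasCompactSupport b) (t : ℝ) :
    HasDerivAt (fun t => ∫ x, b x * H (t, x)) (∫ x, b x * pd ((1:ℝ), (0 : En n)) H (t, x)) t := by
  have hH' := hH.pd ((1:ℝ), (0 : En n))
  have cH : ∀ s : ℝ, Continuous (fun x => H (s, x)) := fun s => (sm_slice hH s).cont
  have cH' : ∀ s : ℝ, Continuous (fun x => pd ((1:ℝ), (0 : En n)) H (s, x)) := fun s => (sm_slice hH' s).cont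
  obtain ⟨C, hC⟩ := (isCompact_Icc (a := t - 1) (b := t + 1)).prod hc |>.exists_bound_of_continuousOn
    hH'.cont.continuousOn
  have hib : Integrable b := hb.integrable_of_hasCompactSupport hc
  refine (hasDerivAt_integral_of_dominated_loc_of_deriv_le (μ := volume) (s := Icc (t - 1) (t + 1))
    (bound := fun x => |b x| * C) (F := fun t x => b x * H (t, x))
    (F' := fun t x => b x * pd ((1:ℝ), (0 : En n)) H (t, x)) ?_ ?_ ?_ ?_ ?_ ?_ ?_).2
  · exact Icc_mem_nhds (by linarith) (by linarith)
  · exact Filter.Eventually.of_forall fun s => (hb.mul (cH s)).aestronglyMeasurable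
  · exact (hb.mul (cH t)).integrable_of_hasCompactSupport hc.mul_right
  · exact (hb.mul (cH' t)).aestronglyMeasurable
  · filter_upwards with x s hs
    rw [norm_mul, Real.norm_eq_abs]
    by_cases hx : x ∈ tsupport b
    · exact mul_le_mul_of_nonneg_left (hC (s, x) ⟨hs, hx⟩) (abs_nonneg _)
    · rw [image_eq_zero_of_notMem_tsupport hx]; simp
  · exact hib.abs.mul_const C
  · filter_upwards with x s hs
    exact (hasDerivAt_time hH s x).const_mul (b x)

lemma Mom_deriv {V W : ℝ × En n → ℝ} (hV : Sm V) (hW : Sm W) {a : En n → ℝ} (ha : Sm a)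
    (hc : HasCompactSupport a) (t : ℝ) :
    HasDerivAt (fun t => Mom a (fun x => V (t, x)) (fun x => W (t, x)))
      (Mder a (fun x => V (t, x)) (fun x => W (t, x)) (fun x => pd ((1:ℝ), (0 : En n)) V (t, x))
        (fun x => pd ((1:ℝ), (0 : En n)) W (t, x))) t := by
  unfold Mom Mder
  apply HasDerivAt.fun_sum
  intro k _
  apply HasDerivAt.const_mul
  simp only [pd_slice hV, pd_slice hW]
  set τ : ℝ × En n := ((1:ℝ), (0 : En n)) with hτ
  set κ : ℝ × En n := ((0:ℝ), eb k) with hκ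
  have sVk := hV.pd κ
  have sWk := hW.pd κ
  have sVt := hV.pd τ
  have sWt := hW.pd τ
  have sVtk := sVt.pd κ
  have sWtk := sWt.pd κ
  have sak := ha.pd (eb k)
  have cak := hc.pd (eb k)
  have sakk := sak.pd (eb k)
  have cakk := cak.pd (eb k)
  have h1 := diff_int ((hV.mul sWk).sub (hW.mul sVk)) sak.cont cak t
  refine h1.congr_deriv ?_
  symm
  -- slices
  let v : En n → ℝ := fun x => V (t, x)
  let w : En n → ℝ := fun x => W (t, x)
  let vt : En n → ℝ := fun x => pd τ V (t, x)
  let wt : En n → ℝ := fun x => pd τ W (t, x)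
  have sv : Sm v := sm_slice hV t
  have sw : Sm w := sm_slice hW t
  have svt : Sm vt := sm_slice sVt t
  have swt : Sm wt := sm_slice sWt t
  let P : En n → ℝ := fun x => pd (eb k) a x * (v x * wt x - w x * vt x)
  have sP : Sm P := sak.mul ((sv.mul swt).sub (sw.mul svt))
  have cP : HasCompactSupport P := cak.mul_right
  have z := integral_pd_zero_cs (eb k) sP cP
  have iP : Integrable (pd (eb k) P) := (sP.pd _).cont.integrable_of_hasCompactSupport (cP.pd _)
  have i2 : Integrable (fun x => pd (eb k) a x * pd τ (fun x => V x * pd κ W x - W x * pd κ V x) (t, x)) :=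
    (sak.cont.mul (sm_slice (((hV.mul sWk).sub (hW.mul sVk)).pd τ) t).cont).integrable_of_hasCompactSupport cak.mul_right
  have h0 : ∫ x, pd (eb k) a x * pd τ (fun x => V x * pd κ W x - W x * pd κ V x) (t, x)
      = ∫ x, (pd (eb k) a x * pd τ (fun x => V x * pd κ W x - W x * pd κ V x) (t, x) - pd (eb k) P x) := by
    rw [integral_sub i2 iP, z, sub_zero]
  refine Eq.trans ?_ h0.symm
  congr 1; funext x
  have e1 : pd τ (fun x => V x * pd κ W x - W x * pd κ V x) (t, x)
     = (vt x * pd κ W (t, x) + v x * pd κ (pd τ W) (t, x)) - (wt x * pd κ V (t, x) + w x * pd κ (pd τ V) (t, x)) := by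
    rw [pd_sub ((hV.mul sWk).at _) ((hW.mul sVk).at _), pd_mul (hV.at _) (sWk.at _), pd_mul (hW.at _) (sVk.at _),
      pd_comm hW τ κ, pd_comm hV τ κ]
  have ev : pd (eb k) v x = pd κ V (t, x) := congrFun (pd_slice hV t (eb k)) x
  have ew : pd (eb k) w x = pd κ W (t, x) := congrFun (pd_slice hW t (eb k)) x
  have evt : pd (eb k) vt x = pd κ (pd τ V) (t, x) := congrFun (pd_slice sVt t (eb k)) x
  have ewt : pd (eb k) wt x = pd κ (pd τ W) (t, x) := congrFun (pd_slice sWt t (eb k)) x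
  have e2 : pd (eb k) P x = pd (eb k) (pd (eb k) a) x * (v x * wt x - w x * vt x)
      + pd (eb k) a x * ((pd κ V (t, x) * wt x + v x * pd κ (pd τ W) (t, x)) - (pd κ W (t, x) * vt x + w x * pd κ (pd τ V) (t, x))) := by
    simp only [P]
    rw [pd_mul (sak.at x) (((sv.mul swt).sub (sw.mul svt)).at x), pd_sub ((sv.mul swt).at x) ((sw.mul svt).at x),
      pd_mul (sv.at x) (swt.at x), pd_mul (sw.at x) (svt.at x), ev, ew, evt, ewt]
  rw [e1, e2]
  simp only [v, w, vt, wt]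
  ring

end TimeDer

section Schw
variable {n : ℕ}

lemma nice_of_schwartz (ψ : SchwartzMap (En n) ℝ) : Nice (ψ : En n → ℝ) where
  sm := ψ.smooth ⊤
  bdd := ⟨‖ψ.toBoundedContinuousFunction‖, fun x => ψ.toBoundedContinuousFunction.norm_coe_le_norm x⟩
  isq := (ψ.memLp 2 volume).integrable_sq
  igrad := fun j => by
    have := ((LineDeriv.lineDerivOp (eb j) ψ).memLp 2 volume).integrable_sq
    simp only [SchwartzMap.lineDerivOp_apply_eq_fderiv] at this
    exact this

/-- real part -/
def reP (f : En n → ℂ) : En n → ℝ := fun x => (f x).re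
/-- imaginary part -/
def imP (f : En n → ℂ) : En n → ℝ := fun x => (f x).im

lemma nice_re (φ : SchwartzMap (En n) ℂ) : Nice (reP φ) :=
  nice_of_schwartz (SchwartzMap.postcompCLM Complex.reCLM φ)
lemma nice_im (φ : SchwartzMap (En n) ℂ) : Nice (imP φ) :=
  nice_of_schwartz (SchwartzMap.postcompCLM Complex.imCLM φ)

lemma pd_re {f : En n → ℂ} (hf : ContDiff ℝ (⊤ : ℕ∞) f) (e x : En n) : pd e (reP f) x = (fderiv ℝ f x e).re := by
  have h := Complex.reCLM.hasFDerivAt.comp x (hf.differentiable (by simp) x).hasFDerivAt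
  show fderiv ℝ (Complex.reCLM ∘ f) x e = _
  rw [h.fderiv]; simp

lemma pd_im {f : En n → ℂ} (hf : ContDiff ℝ (⊤ : ℕ∞) f) (e x : En n) : pd e (imP f) x = (fderiv ℝ f x e).im := by
  have h := Complex.imCLM.hasFDerivAt.comp x (hf.differentiable (by simp) x).hasFDerivAt
  show fderiv ℝ (Complex.imCLM ∘ f) x e = _
  rw [h.fderiv]; simp

lemma snd_der {f : En n → ℂ} (hf : ContDiff ℝ (⊤ : ℕ∞) f) (e x : En n) :
    iteratedFDeriv ℝ 2 f x ![e, e] = fderiv ℝ (fun y => fderiv ℝ f y e) x e := by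
  have hd : DifferentiableAt ℝ (fderiv ℝ f) x :=
    ((hf.fderiv_right (m := (⊤ : ℕ∞)) (by simp)).differentiable (by simp)) x
  rw [iteratedFDeriv_two_apply, fderiv_clm_apply hd (by fun_prop)]
  simp

lemma lap_re {f : En n → ℂ} (hf : ContDiff ℝ (⊤ : ℕ∞) f) (x : En n) :
    (lapC f x).re = ∑ j, pd (eb j) (pd (eb j) (reP f)) x := by
  unfold lapC
  rw [Complex.re_sum]
  apply Finset.sum_congr rfl; intro j _
  have h1 : ContDiff ℝ (⊤ : ℕ∞) (fun y => fderiv ℝ f y (eb j)) :=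
    (hf.fderiv_right (m := (⊤ : ℕ∞)) (by simp)).clm_apply contDiff_const
  rw [snd_der hf, funext (pd_re hf (eb j)), ← pd_re h1]
  rfl

lemma lap_im {f : En n → ℂ} (hf : ContDiff ℝ (⊤ : ℕ∞) f) (x : En n) :
    (lapC f x).im = ∑ j, pd (eb j) (pd (eb j) (imP f)) x := by
  unfold lapC
  rw [Complex.im_sum]
  apply Finset.sum_congr rfl; intro j _
  have h1 : ContDiff ℝ (⊤ : ℕ∞) (fun y => fderiv ℝ f y (eb j)) :=
    (hf.fderiv_right (m := (⊤ : ℕ∞)) (by simp)).clm_apply contDiff_const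
  rw [snd_der hf, funext (pd_im hf (eb j)), ← pd_im h1]
  rfl

lemma norm_sq_rho (f : En n → ℂ) (x : En n) : ‖f x‖ ^ 2 = rho (reP f) (imP f) x := by
  rw [Complex.sq_norm, Complex.normSq_apply]; unfold rho reP imP; ring

lemma pot_eq (f : En n → ℂ) (x : En n) : hartreePotential f x = pot (rho (reP f) (imP f)) x := by
  unfold hartreePotential pot
  simp only [norm_sq_rho]

lemma kin_nonneg (v w : En n → ℝ) : 0 ≤ kin v w := by
  unfold kin
  apply add_nonneg <;> exact integral_nonneg fun x => Finset.sum_nonneg fun j _ => sq_nonneg _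

lemma pote_nonneg (v w : En n → ℝ) : 0 ≤ pote v w := by
  unfold pote
  apply integral_nonneg
  intro p
  have h1 := rho_nonneg v w p.1
  have h2 := rho_nonneg v w p.2
  show 0 ≤ _
  positivity

lemma energy_eq (hn : 5 ≤ n) (φ : SchwartzMap (En n) ℂ) :
    energy n φ = (1/2) * kin (reP φ) (imP φ) + (1/4) * pote (reP φ) (imP φ) := by
  have hf : ContDiff ℝ (⊤ : ℕ∞) φ := φ.smooth ⊤
  have hv := nice_re φ
  have hw := nice_im φ
  unfold energy
  congr 2
  · unfold kin
    rw [← integral_add (integrable_finsetSum _ fun j _ => hv.igrad j) (integrable_finsetSum _ fun j _ => hw.igrad j)]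
    congr 1; funext x
    rw [← Finset.sum_add_distrib]
    apply Finset.sum_congr rfl; intro j _
    rw [pd_re hf, pd_im hf, Complex.sq_norm, Complex.normSq_apply]; ring
  · obtain ⟨B, hB⟩ := rho_bdd hv hw
    unfold pote
    rw [Measure.volume_eq_prod, integral_prod _ (kernel_integrable hn (le_refl 4) (rho_int hv hw) (rho_int hv hw) hB)]
    simp only [norm_sq_rho, mul_assoc]

end Schw


section FTC
variable {n : ℕ}

lemma ext_smooth {u : ℝ → En n → ℂ} {t₁ t₂ a b : ℝ} (h1 : t₁ < a) (hab : a < b) (h2 : b < t₂)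
    (hu : ContDiffOn ℝ (⊤ : ℕ∞) (fun p : ℝ × En n => u p.1 p.2) (Icc t₁ t₂ ×ˢ univ)) :
    ∃ U : ℝ × En n → ℂ, ContDiff ℝ (⊤ : ℕ∞) U ∧ ∀ t ∈ Icc a b, ∀ x, U (t, x) = u t x := by
  obtain ⟨ε, hε, hε1, hε2⟩ : ∃ ε > 0, t₁ < a - ε ∧ b + ε < t₂ :=
    ⟨min ((a - t₁) / 2) ((t₂ - b) / 2), by apply lt_min <;> linarith,
      by linarith [min_le_left ((a - t₁) / 2) ((t₂ - b) / 2)],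
      by linarith [min_le_right ((a - t₁) / 2) ((t₂ - b) / 2)]⟩
  let χ : ContDiffBump ((a + b) / 2) := ⟨(b - a) / 2, (b - a) / 2 + ε, by linarith, by linarith⟩
  refine ⟨fun p => ((χ p.1 : ℝ) : ℝ) • u p.1 p.2, ?_, ?_⟩
  · rw [contDiff_iff_contDiffAt]
    rintro ⟨t, x⟩
    by_cases ht : t ∈ Ioo t₁ t₂
    · have hc : ContDiffAt ℝ (⊤ : ℕ∞) (fun p : ℝ × En n => u p.1 p.2) (t, x) := by
        apply hu.contDiffAt
        exact prod_mem_nhds (Icc_mem_nhds ht.1 ht.2) Filter.univ_mem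
      have hχ : ContDiffAt ℝ (⊤ : ℕ∞) (fun p : ℝ × En n => χ p.1) (t, x) :=
        (χ.contDiff (n := ⊤)).contDiffAt.comp (t, x) contDiffAt_fst
      exact hχ.smul hc
    · have hz : (fun p : ℝ × En n => (χ p.1 : ℝ) • u p.1 p.2) =ᶠ[nhds (t, x)] fun _ => 0 := by
        have : {p : ℝ × En n | (b - a) / 2 + ε < dist p.1 ((a + b) / 2)} ∈ nhds (t, x) := by
          apply IsOpen.mem_nhds (isOpen_lt continuous_const (by fun_prop))
          show (b - a) / 2 + ε < dist t ((a + b) / 2)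
          rw [Real.dist_eq, lt_abs]
          by_cases h : t₁ < t
          · left; have : t₂ ≤ t := by by_contra hh; exact ht ⟨h, not_le.1 hh⟩
            linarith
          · right; linarith
        filter_upwards [this] with p hp
        rw [χ.zero_of_le_dist hp.le, zero_smul]
      exact contDiffAt_const.congr_of_eventuallyEq hz
  · intro t ht x
    show (χ t : ℝ) • u t x = u t x
    rw [χ.one_of_mem_closedBall, one_smul]
    rw [mem_closedBall_iff_norm, Real.norm_eq_abs, abs_le]
    show -((b - a) / 2) ≤ _ ∧ _ ≤ (b - a) / 2
    constructor <;> linarith [ht.1, ht.2]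

/-- Density of the solution at time `t`. -/
def den (u : ℝ → En n → ℂ) (t : ℝ) : En n → ℝ := rho (reP (u t)) (imP (u t))

lemma ftc_step (hn : 5 ≤ n) {K R e d : ℝ} (hK : 0 < K) (hR : 0 < R) (he : 0 < e) (hd : 0 < d)
    {w₀ : En n → ℝ} (hwt : IsWeight n K R e w₀) {u : ℝ → En n → ℂ} {t₁ t₂ a b : ℝ}
    (h1 : t₁ < a) (hab : a < b) (h2 : b < t₂) (hu : IsHartreeSolution n (Icc t₁ t₂) u) {E₀ : ℝ}
    (hE : ∀ t ∈ Icc t₁ t₂, energy n (u t) ≤ E₀)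
    (hPhi : IntegrableOn (fun t => Phi R e d (den u t)) (Icc a b)) :
    ∫ t in Icc a b, Phi R e d (den u t) ≤ 4 * K * R * (5 * n + 1) * E₀ + (b - a) * (34 * K / R * E₀) := by
  obtain ⟨U, hU, hUu⟩ := ext_smooth h1 hab h2 hu.smooth
  let V : ℝ × En n → ℝ := fun p => (U p).re
  let W : ℝ × En n → ℝ := fun p => (U p).im
  have sV : Sm V := Complex.reCLM.contDiff.comp hU
  have sW : Sm W := Complex.imCLM.contDiff.comp hU
  have hsub : ∀ t ∈ Icc a b, t ∈ Icc t₁ t₂ := fun t ht => ⟨by linarith [ht.1], by linarith [ht.2]⟩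
  have eV : ∀ t ∈ Icc a b, (fun x => V (t, x)) = reP (u t) := fun t ht => funext fun x => by
    simp only [V, hUu t ht x, reP]
  have eW : ∀ t ∈ Icc a b, (fun x => W (t, x)) = imP (u t) := fun t ht => funext fun x => by
    simp only [W, hUu t ht x, imP]
  have hnice : ∀ t ∈ Icc a b, Nice (reP (u t)) ∧ Nice (imP (u t)) ∧ ContDiff ℝ (⊤ : ℕ∞) (u t)
      ∧ energy n (u t) = (1/2) * kin (reP (u t)) (imP (u t)) + (1/4) * pote (reP (u t)) (imP (u t)) := by
    intro t ht
    obtain ⟨φ, hφ⟩ := hu.schwartz t (hsub t ht)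
    rw [← hφ]
    exact ⟨nice_re φ, nice_im φ, φ.smooth ⊤, energy_eq hn φ⟩
  have hkin : ∀ t ∈ Icc a b, kin (reP (u t)) (imP (u t)) ≤ 2 * E₀ ∧ pote (reP (u t)) (imP (u t)) ≤ 4 * E₀ 
      ∧ 9 * kin (reP (u t)) (imP (u t)) + 4 * pote (reP (u t)) (imP (u t)) ≤ 34 * E₀ := by
    intro t ht
    have h := (hnice t ht).2.2.2
    have h' := hE t (hsub t ht)
    have k0 := kin_nonneg (reP (u t)) (imP (u t))
    have p0 := pote_nonneg (reP (u t)) (imP (u t))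
    refine ⟨by linarith, by linarith, by linarith⟩
  let g : ℝ → ℝ := fun t => Mom w₀ (fun x => V (t, x)) (fun x => W (t, x))
  let g' : ℝ → ℝ := fun t => Mder w₀ (fun x => V (t, x)) (fun x => W (t, x)) (fun x => pd ((1:ℝ), (0 : En n)) V (t, x))
        (fun x => pd ((1:ℝ), (0 : En n)) W (t, x))
  have hg : ∀ t, HasDerivAt g (g' t) t := fun t => Mom_deriv sV sW hwt.sm hwt.cs t
  have hgb : ∀ t ∈ Icc a b, |g t| ≤ K * R * (5 * n + 1) * (2 * E₀) := by
    intro t ht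
    simp only [g, eV t ht, eW t ht]
    refine (Mom_bound hn hK hR hwt (hnice t ht).1 (hnice t ht).2.1).trans ?_
    exact mul_le_mul_of_nonneg_left (hkin t ht).1 (by positivity)
  have hφ : ∀ t ∈ Ioo a b, Phi R e d (den u t) - 34 * K / R * E₀ ≤ g' t := by
    intro t ht
    have ht' : t ∈ Icc a b := Ioo_subset_Icc_self ht
    have ht0 := hsub t ht'
    obtain ⟨nv, nw, cu, -⟩ := hnice t ht'
    have hder : ∀ x, HasDerivAt (fun s => u s x) (⟨pd ((1:ℝ), (0 : En n)) V (t, x), pd ((1:ℝ), (0 : En n)) W (t, x)⟩ : ℂ) t := by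
      intro x
      have hv := (hasDerivAt_time sV t x).ofReal_comp
      have hw := ((hasDerivAt_time sW t x).ofReal_comp).mul_const Complex.I
      have h := hv.add hw
      have ev : (fun s => u s x) =ᶠ[nhds t] ((fun s => ((V (s, x) : ℝ) : ℂ)) + fun s => ((W (s, x) : ℝ) : ℂ) * Complex.I) := by
        filter_upwards [Ioo_mem_nhds ht.1 ht.2] with s hs
        have := hUu s (Ioo_subset_Icc_self hs) x
        simp only [Pi.add_apply, V, W]
        rw [Complex.re_add_im, this]
      refine (h.congr_of_eventuallyEq ev).congr_deriv ?_
      apply Complex.ext <;> simp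
    have heq : ∀ x, _ := hu.eqn t ht0
    have hL := Mder_lower hn hK hR he hd hwt nv nw
      (vt := fun x => pd ((1:ℝ), (0 : En n)) V (t, x)) (wt := fun x => pd ((1:ℝ), (0 : En n)) W (t, x))
      (by
        intro x
        have h := congrArg Complex.im (heq x)
        rw [(hder x).deriv, pot_eq] at h
        simp only [Complex.add_im, Complex.mul_im, Complex.I_re, Complex.I_im, lap_im cu,
          Complex.ofReal_re, Complex.ofReal_im] at h
        have hi : imP (u t) x = (u t x).im := rfl
        rw [hi]
        linarith)
      (by
        intro x
        have h := congrArg Complex.re (heq x)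
        rw [(hder x).deriv, pot_eq] at h
        simp only [Complex.add_re, Complex.mul_re, Complex.I_re, Complex.I_im, lap_re cu,
          Complex.ofReal_re, Complex.ofReal_im] at h
        have hi : reP (u t) x = (u t x).re := rfl
        rw [hi]
        linarith)
    simp only [g', eV t ht', eW t ht']
    refine le_trans ?_ hL
    have : K / R * (9 * kin (reP (u t)) (imP (u t)) + 4 * pote (reP (u t)) (imP (u t))) ≤ K / R * (34 * E₀) :=
      mul_le_mul_of_nonneg_left (hkin t ht').2.2 (by positivity)
    have e2 : K / R * (34 * E₀) = 34 * K / R * E₀ := by ring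
    unfold den
    linarith
  have hcI : IntegrableOn (fun _ : ℝ => 34 * K / R * E₀) (Icc a b) := continuous_const.integrableOn_Icc
  have key := intervalIntegral.integral_le_sub_of_hasDeriv_right_of_le hab.le
    (fun t _ => (hg t).continuousAt.continuousWithinAt) (fun t _ => (hg t).hasDerivWithinAt)
    (φ := fun t => Phi R e d (den u t) - 34 * K / R * E₀) (hPhi.sub hcI) hφ
  rw [intervalIntegral.integral_of_le hab.le, ← integral_Icc_eq_integral_Ioc, integral_sub hPhi hcI] at key
  have hc : ∫ _t in Icc a b, 34 * K / R * E₀ = (b - a) * (34 * K / R * E₀) := by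
    rw [setIntegral_const, smul_eq_mul, Real.volume_real_Icc_of_le hab.le]
  rw [hc] at key
  have ba := abs_le.1 (hgb a (left_mem_Icc.2 hab.le))
  have bb := abs_le.1 (hgb b (right_mem_Icc.2 hab.le))
  nlinarith [ba.1, bb.2]

end FTC


section Limit
open Filter Topology

lemma term_limit {X : Type*} [TopologicalSpace X] [SecondCountableTopology X] [MeasureSpace X] [BorelSpace X]
    [T2Space X] [SFinite (volume : Measure X)] {Z : Set X} (hZ : IsCompact Z) {a b : ℝ} {D : ℝ × X → ℝ}
    (hD : ContinuousOn D (Icc a b ×ˢ Z)) {Gm : ℕ → X → ℝ} {G H : X → ℝ}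
    (hm : ∀ m, Measurable (Gm m)) (hH : IntegrableOn H Z)
    (hb : ∀ m, ∀ᵐ x ∂(volume.restrict Z), |Gm m x| ≤ H x)
    (hl : ∀ᵐ x ∂(volume.restrict Z), Tendsto (fun m => Gm m x) atTop (𝓝 (G x)))
    (hz : ∀ m, ∀ x ∉ Z, Gm m x = 0) (hz0 : ∀ x ∉ Z, G x = 0) :
    (∀ m, IntegrableOn (fun t => ∫ x, Gm m x * D (t, x)) (Icc a b)) ∧
    IntegrableOn (fun t => ∫ x, G x * D (t, x)) (Icc a b) ∧
    Tendsto (fun m => ∫ t in Icc a b, ∫ x, Gm m x * D (t, x)) atTop (𝓝 (∫ t in Icc a b, ∫ x, G x * D (t, x))) ∧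
    ∀ᵐ t ∂(volume.restrict (Icc a b)), IntegrableOn (fun x => G x * D (t, x)) Z := by
  have mZ : MeasurableSet Z := hZ.isClosed.measurableSet
  obtain ⟨B, hB⟩ := (isCompact_Icc.prod hZ).exists_bound_of_continuousOn hD
  set μ : Measure (ℝ × X) := (volume.restrict (Icc a b)).prod (volume.restrict Z) with hμ
  have eμ : μ = (volume.prod volume).restrict (Icc a b ×ˢ Z) := Measure.prod_restrict _ _
  have hDm : AEStronglyMeasurable D μ := by
    rw [eμ]; exact hD.aestronglyMeasurable (measurableSet_Icc.prod mZ)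
  have hDB : ∀ᵐ p ∂μ, ‖D p‖ ≤ B := by
    rw [eμ]; exact (ae_restrict_mem (measurableSet_Icc.prod mZ)).mono fun p hp => hB p hp
  have hq : Measure.QuasiMeasurePreserving (Prod.snd : ℝ × X → X) μ (volume.restrict Z) :=
    Measure.quasiMeasurePreserving_snd
  have hGm : ∀ m, AEStronglyMeasurable (fun p : ℝ × X => Gm m p.2 * D p) μ := fun m =>
    ((hm m).comp measurable_snd).aestronglyMeasurable.mul hDm
  have hbound : Integrable (fun p : ℝ × X => H p.2 * B) μ := (hH.comp_snd (volume.restrict (Icc a b))).mul_const B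
  have hbm : ∀ m, ∀ᵐ p ∂μ, ‖Gm m p.2 * D p‖ ≤ H p.2 * B := by
    intro m
    filter_upwards [hq.ae (hb m), hDB] with p h1 h2
    rw [norm_mul]
    exact mul_le_mul h1 h2 (norm_nonneg _) ((abs_nonneg _).trans h1)
  have hlim : ∀ᵐ p ∂μ, Tendsto (fun m => Gm m p.2 * D p) atTop (𝓝 (G p.2 * D p)) := by
    filter_upwards [hq.ae hl] with p h1
    exact h1.mul_const _
  have iGm : ∀ m, Integrable (fun p : ℝ × X => Gm m p.2 * D p) μ := fun m =>
    hbound.mono' (hGm m) (hbm m)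
  have hG : AEStronglyMeasurable (fun p : ℝ × X => G p.2 * D p) μ :=
    aestronglyMeasurable_of_tendsto_ae atTop hGm hlim
  have iG : Integrable (fun p : ℝ × X => G p.2 * D p) μ := by
    refine hbound.mono' hG ?_
    filter_upwards [ae_all_iff.2 hbm, hlim] with p h1 h2
    exact le_of_tendsto h2.norm (Eventually.of_forall h1)
  have T := tendsto_integral_of_dominated_convergence _ hGm hbound hbm hlim
  have e1 : ∀ m t, ∫ x in Z, Gm m x * D (t, x) = ∫ x, Gm m x * D (t, x) := fun m t =>
    setIntegral_eq_integral_of_forall_compl_eq_zero fun x hx => by rw [hz m x hx, zero_mul]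
  have e2 : ∀ t, ∫ x in Z, G x * D (t, x) = ∫ x, G x * D (t, x) := fun t =>
    setIntegral_eq_integral_of_forall_compl_eq_zero fun x hx => by rw [hz0 x hx, zero_mul]
  refine ⟨fun m => ?_, ?_, ?_, iG.prod_right_ae⟩
  · have := (iGm m).integral_prod_left
    simp only [e1] at this
    exact this
  · have := iG.integral_prod_left
    simp only [e2] at this
    exact this
  · rw [integral_prod _ iG] at T
    have e3 : ∀ m, ∫ p, Gm m p.2 * D p ∂μ = ∫ t in Icc a b, ∫ x, Gm m x * D (t, x) := by
      intro m
      rw [integral_prod _ (iGm m)]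
      simp only [e1]
    simp only [e2] at T
    exact T.congr e3

variable {n : ℕ}

lemma pw_zero (x : En n) : pw 0 x = ‖x‖⁻¹ := by
  unfold pw; rw [add_zero, Real.sqrt_sq (norm_nonneg x)]

lemma pw_tendsto {em : ℕ → ℝ} (h : Tendsto em atTop (𝓝 0)) {x : En n} (hx : x ≠ 0) :
    Tendsto (fun m => pw (em m) x) atTop (𝓝 (pw 0 x)) := by
  unfold pw
  apply Tendsto.inv₀
  · exact (Real.continuous_sqrt.tendsto _).comp (tendsto_const_nhds.add h)
  · rw [add_zero, Real.sqrt_sq (norm_nonneg x)]; exact norm_ne_zero_iff.2 hx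

lemma Pd_meas {R e : ℝ} (he : 0 < e) : Measurable (fun x : En n => Pd R e x) := by
  unfold Pd
  have cp : Continuous (pw (n := n) e) := (sm_pw he).cont
  apply Measurable.ite
  · exact (isClosed_le (by fun_prop) (by fun_prop)).measurableSet
  · exact (by fun_prop : Continuous _).measurable
  · fun_prop

lemma Qd_meas {R e d : ℝ} (he : 0 < e) (hd : 0 < d) : Measurable (fun p : En n × En n => Qd R e d p.1 p.2) := by
  have hs : 0 < d ^ 2 := by positivity
  have cp : Continuous (fun p : En n × En n => pw (d ^ 2) (p.1 - p.2)) := (sm_pw hs).cont.comp (by fun_prop)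
  unfold Qd
  apply Measurable.ite
  · exact (isClosed_le (by fun_prop) (by fun_prop) |>.inter
      (isClosed_le (by fun_prop) (by fun_prop)) : IsClosed ({p : En n × En n | ‖p.1‖ ≤ R} ∩ {p | ‖p.2‖ ≤ R})).measurableSet
  · have := Dm_meas (n := n) he
    exact (by fun_prop : Continuous _).measurable
  · fun_prop

lemma Dm_inner (e : ℝ) (x y : En n) : Dm e x y = ⟪x - y, pw e x • x - pw e y • y⟫ := by
  unfold Dm
  rw [PiLp.inner_apply]
  apply Finset.sum_congr rfl; intro k _
  simp [mul_comm]

lemma Dm_le {e : ℝ} (he : 0 < e) (x y : En n) : Dm e x y ≤ 2 * ‖x - y‖ ^ 2 * pw e x := by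
  rw [Dm_inner]
  refine (real_inner_le_norm _ _).trans ?_
  have px := pw_pos he x
  have py := pw_pos he y
  have e1 : pw e x • x - pw e y • y = pw e x • (x - y) + (pw e x - pw e y) • y := by
    rw [smul_sub, sub_smul]; abel
  have qx : qw e x * pw e x = 1 := mul_inv_cancel₀ (Real.sqrt_pos.2 (base_pos he x)).ne'
  have qy : qw e y * pw e y = 1 := mul_inv_cancel₀ (Real.sqrt_pos.2 (base_pos he y)).ne'
  have qx2 : qw e x ^ 2 = ‖x‖ ^ 2 + e := Real.sq_sqrt (base_pos he x).le
  have qy2 : qw e y ^ 2 = ‖y‖ ^ 2 + e := Real.sq_sqrt (base_pos he y).le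
  have qx0 : 0 < qw e x := Real.sqrt_pos.2 (base_pos he x)
  have qy0 : 0 < qw e y := Real.sqrt_pos.2 (base_pos he y)
  have yq : ‖y‖ ≤ qw e y := abs_le_of_sq_le_sq' (by linarith) qy0.le |>.2
  have xq : ‖x‖ ≤ qw e x := abs_le_of_sq_le_sq' (by linarith) qx0.le |>.2
  have ypy : ‖y‖ * pw e y ≤ 1 := by rw [← qy]; exact mul_le_mul_of_nonneg_right yq py.le
  have hdiff : |qw e y - qw e x| ≤ ‖x - y‖ := by
    have h1 : |qw e y - qw e x| * (qw e y + qw e x) ≤ ‖x - y‖ * (qw e y + qw e x) := by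
      have : |qw e y - qw e x| * (qw e y + qw e x) = |‖y‖ - ‖x‖| * (‖y‖ + ‖x‖) := by
        have t1 : |qw e y - qw e x| * (qw e y + qw e x) = |qw e y ^ 2 - qw e x ^ 2| := by
          rw [← abs_of_pos (add_pos qy0 qx0), ← abs_mul]; congr 1; ring
        have t2 : |‖y‖ - ‖x‖| * (‖y‖ + ‖x‖) = |‖y‖ ^ 2 - ‖x‖ ^ 2| := by
          rw [← abs_of_nonneg (add_nonneg (norm_nonneg y) (norm_nonneg x)), ← abs_mul]; congr 1; ring
        rw [t1, t2, qx2, qy2]; congr 1; ring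
      rw [this, norm_sub_rev]
      exact mul_le_mul (abs_norm_sub_norm_le y x) (by linarith) (by positivity) (norm_nonneg _)
    exact le_of_mul_le_mul_right h1 (by linarith)
  have hp : |pw e x - pw e y| = pw e x * pw e y * |qw e y - qw e x| := by
    rw [← abs_of_pos (mul_pos px py), ← abs_mul]; congr 1
    linear_combination pw e y * qx - pw e x * qy
  have h2 : ‖pw e x • x - pw e y • y‖ ≤ 2 * ‖x - y‖ * pw e x := by
    rw [e1]
    refine (norm_add_le _ _).trans ?_
    rw [norm_smul, norm_smul, Real.norm_eq_abs, Real.norm_eq_abs, abs_of_pos px, hp]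
    have : pw e x * pw e y * |qw e y - qw e x| * ‖y‖ ≤ pw e x * ‖x - y‖ := by
      calc pw e x * pw e y * |qw e y - qw e x| * ‖y‖ = pw e x * |qw e y - qw e x| * (‖y‖ * pw e y) := by ring
        _ ≤ pw e x * |qw e y - qw e x| * 1 := mul_le_mul_of_nonneg_left ypy (by positivity)
        _ ≤ pw e x * ‖x - y‖ := by rw [mul_one]; exact mul_le_mul_of_nonneg_left hdiff px.le
    linarith
  calc ‖x - y‖ * ‖pw e x • x - pw e y • y‖ ≤ ‖x - y‖ * (2 * ‖x - y‖ * pw e x) :=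
        mul_le_mul_of_nonneg_left h2 (norm_nonneg _)
    _ = _ := by ring

lemma ae_ne_zero (hn : 5 ≤ n) : ∀ᵐ x : En n, x ≠ 0 := by
  have := noAtoms_En hn
  exact (measure_singleton (0 : En n) : volume {(0 : En n)} = 0) |> fun h => by
    rw [ae_iff]; simpa using h

lemma P_limit (hn : 5 ≤ n) {R : ℝ} {a b : ℝ} {ρ : ℝ → En n → ℝ}
    (hρ : ContinuousOn (fun p : ℝ × En n => ρ p.1 p.2) (Icc a b ×ˢ univ)) {em : ℕ → ℝ} (hem : ∀ m, 0 < em m)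
    (hl : Tendsto em atTop (𝓝 0)) :
    (∀ m, IntegrableOn (fun t => ∫ x, Pd R (em m) x * ρ t x) (Icc a b)) ∧
    IntegrableOn (fun t => ∫ x, Pd R 0 x * ρ t x) (Icc a b) ∧
    Tendsto (fun m => ∫ t in Icc a b, ∫ x, Pd R (em m) x * ρ t x) atTop (𝓝 (∫ t in Icc a b, ∫ x, Pd R 0 x * ρ t x)) := by
  have hne := ae_ne_zero hn
  have h := term_limit (X := En n) (isCompact_closedBall (0 : En n) R) (a := a) (b := b) (D := fun p => ρ p.1 p.2)
    (hρ.mono (prod_mono subset_rfl (subset_univ _))) (Gm := fun m x => Pd R (em m) x) (G := fun x => Pd R 0 x)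
    (H := fun x => 8 * (‖x‖ ^ 3)⁻¹) (fun m => Pd_meas (hem m)) ((integrableOn_inv_pow hn (by norm_num) R).const_mul 8)
    (fun m => by
      filter_upwards [ae_restrict_of_ae hne] with x hx
      unfold Pd
      have p := pw_pos (hem m) x
      split_ifs
      · rw [abs_of_nonneg (by positivity), ← inv_pow]
        exact mul_le_mul_of_nonneg_left (pow_le_pow_left₀ p.le (pw_le_norm_inv (hem m).le hx) 3) (by norm_num)
      · rw [abs_zero]; positivity)
    (by
      filter_upwards [ae_restrict_of_ae hne] with x hx
      unfold Pd
      split_ifs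
      · exact ((pw_tendsto hl hx).pow 3).const_mul 8
      · exact tendsto_const_nhds)
    (fun m x hx => by
      unfold Pd; rw [if_neg]; simpa using hx)
    (fun x hx => by
      unfold Pd; rw [if_neg]; simpa using hx)
  exact ⟨h.1, h.2.1, h.2.2.1⟩

lemma Q_limit (hn : 5 ≤ n) {R : ℝ} {a b : ℝ} {ρ : ℝ → En n → ℝ}
    (hρ : ContinuousOn (fun p : ℝ × En n => ρ p.1 p.2) (Icc a b ×ˢ univ)) {em dm : ℕ → ℝ} (hem : ∀ m, 0 < em m)
    (hdm : ∀ m, 0 < dm m) (hl : Tendsto em atTop (𝓝 0)) (hl' : Tendsto dm atTop (𝓝 0)) :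
    (∀ m, IntegrableOn (fun t => ∫ p : En n × En n, Qd R (em m) (dm m) p.1 p.2 * (ρ t p.1 * ρ t p.2)) (Icc a b)) ∧
    IntegrableOn (fun t => ∫ p : En n × En n, Qd R 0 0 p.1 p.2 * (ρ t p.1 * ρ t p.2)) (Icc a b) ∧
    Tendsto (fun m => ∫ t in Icc a b, ∫ p : En n × En n, Qd R (em m) (dm m) p.1 p.2 * (ρ t p.1 * ρ t p.2)) atTop
      (𝓝 (∫ t in Icc a b, ∫ p : En n × En n, Qd R 0 0 p.1 p.2 * (ρ t p.1 * ρ t p.2))) ∧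
    ∀ᵐ t ∂(volume.restrict (Icc a b)), IntegrableOn (fun p : En n × En n => Qd R 0 0 p.1 p.2 * (ρ t p.1 * ρ t p.2))
      (Metric.closedBall 0 R ×ˢ Metric.closedBall 0 R) := by
  have hne : ∀ᵐ p : En n × En n, p.1 ≠ 0 :=
    (Measure.quasiMeasurePreserving_fst (μ := (volume : Measure (En n))) (ν := (volume : Measure (En n)))).ae (ae_ne_zero hn)
  have hne2 : ∀ᵐ p : En n × En n, p.2 ≠ 0 :=
    (Measure.quasiMeasurePreserving_snd (μ := (volume : Measure (En n))) (ν := (volume : Measure (En n)))).ae (ae_ne_zero hn)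
  have hnd := ae_ne hn
  let Bl : Set (En n) := Metric.closedBall 0 R
  have mB : MeasurableSet Bl := Metric.isClosed_closedBall.measurableSet
  have hout : ∀ (e d : ℝ) (p : En n × En n), p ∉ Bl ×ˢ Bl → Qd R e d p.1 p.2 = 0 := by
    intro e d p hp
    unfold Qd; rw [if_neg]; simpa [Bl] using hp
  have iH : IntegrableOn (fun p : En n × En n => 8 * ((‖p.1 - p.2‖ ^ 4)⁻¹ * ‖p.1‖⁻¹)) (Bl ×ˢ Bl) := by
    have i1 : Integrable (Bl.indicator (fun x : En n => (‖x‖ ^ 1)⁻¹)) :=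
      (integrableOn_inv_pow hn (by norm_num) R).integrable_indicator mB
    have i2 : Integrable (Bl.indicator (fun _ : En n => (1 : ℝ))) := by
      have : IntegrableOn (fun _ : En n => (1 : ℝ)) Bl :=
        continuousOn_const.integrableOn_compact (isCompact_closedBall _ _)
      exact this.integrable_indicator mB
    have hk := (kernel_integrable hn (le_refl 4) i1 i2 (B := 1) (fun x => by
      by_cases hx : x ∈ Bl <;> simp [hx])).const_mul 8
    refine (hk.integrableOn (s := Bl ×ˢ Bl)).congr_fun (fun p hp => ?_) (mB.prod mB)
    simp only [indicator_of_mem hp.1, indicator_of_mem hp.2, pow_one, mul_one]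
  refine term_limit (X := En n × En n) ((isCompact_closedBall (0 : En n) R).prod (isCompact_closedBall (0 : En n) R))
    (a := a) (b := b) (D := fun p => ρ p.1 p.2.1 * ρ p.1 p.2.2)
    ?_ (Gm := fun m p => Qd R (em m) (dm m) p.1 p.2) (G := fun p => Qd R 0 0 p.1 p.2)
    (H := fun p => 8 * ((‖p.1 - p.2‖ ^ 4)⁻¹ * ‖p.1‖⁻¹)) (fun m => Qd_meas (hem m) (hdm m)) iH ?_ ?_
    (fun m => hout _ _) (hout _ _)
  · apply ContinuousOn.mul
    · exact hρ.comp (f := fun p : ℝ × En n × En n => (p.1, p.2.1)) (by fun_prop) (fun p hp => ⟨hp.1, mem_univ _⟩)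
    · exact hρ.comp (f := fun p : ℝ × En n × En n => (p.1, p.2.2)) (by fun_prop) (fun p hp => ⟨hp.1, mem_univ _⟩)
  · intro m
    filter_upwards [ae_restrict_of_ae hne, ae_restrict_of_ae hnd] with p h1 h2
    have hsub : p.1 - p.2 ≠ 0 := sub_ne_zero.2 h2
    have hz : 0 < ‖p.1 - p.2‖ := norm_pos_iff.2 hsub
    have hd2 : 0 < dm m ^ 2 := by have := hdm m; positivity
    have p6 := pw_pos hd2 (p.1 - p.2)
    have px := pw_pos (hem m) p.1
    have D0 := Dm_nonneg (hem m) p.1 p.2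
    unfold Qd
    split_ifs
    · rw [abs_of_nonneg (by positivity)]
      have k1 : pw (dm m ^ 2) (p.1 - p.2) ^ 6 ≤ ‖p.1 - p.2‖⁻¹ ^ 6 :=
        pow_le_pow_left₀ p6.le (pw_le_norm_inv hd2.le hsub) 6
      have k2 : Dm (em m) p.1 p.2 ≤ 2 * ‖p.1 - p.2‖ ^ 2 * ‖p.1‖⁻¹ :=
        (Dm_le (hem m) _ _).trans (mul_le_mul_of_nonneg_left (pw_le_norm_inv (hem m).le h1) (by positivity))
      calc 4 * (Dm (em m) p.1 p.2 * pw (dm m ^ 2) (p.1 - p.2) ^ 6)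
          ≤ 4 * ((2 * ‖p.1 - p.2‖ ^ 2 * ‖p.1‖⁻¹) * ‖p.1 - p.2‖⁻¹ ^ 6) := by
            apply mul_le_mul_of_nonneg_left _ (by norm_num)
            exact mul_le_mul k2 k1 (by positivity) (by positivity)
        _ = _ := by field_simp; norm_num
    · rw [abs_zero]; positivity
  · filter_upwards [ae_restrict_of_ae hne, ae_restrict_of_ae hne2, ae_restrict_of_ae hnd] with p h1 h2 h3
    have hsub : p.1 - p.2 ≠ 0 := sub_ne_zero.2 h3
    unfold Qd
    split_ifs
    · apply Tendsto.const_mul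
      apply Tendsto.mul
      · unfold Dm
        apply tendsto_finsetSum
        intro k _
        apply Tendsto.const_mul
        exact ((pw_tendsto hl h1).const_mul _).sub ((pw_tendsto hl h2).const_mul _)
      · apply Tendsto.pow
        have : Tendsto (fun m => dm m ^ 2) atTop (𝓝 0) := by simpa using hl'.pow 2
        have e0 : ((0:ℝ) ^ 2) = 0 := by norm_num
        rw [e0]
        exact pw_tendsto this hsub
    · exact tendsto_const_nhds

end Limit


section Final
open Filter Topology
variable {n : ℕ}

lemma phi_bound_ab (hn : 5 ≤ n) {K R : ℝ} (hK : 0 < K) (hR : 0 < R)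
    (hw : ∀ s : ℝ, 0 < s → s ≤ 1 → ∃ w₀ : En n → ℝ, IsWeight n K R (s * R ^ 2) w₀)
    {u : ℝ → En n → ℂ} {t₁ t₂ a b : ℝ}
    (h1 : t₁ < a) (hab : a < b) (h2 : b < t₂) (hu : IsHartreeSolution n (Icc t₁ t₂) u) {E₀ : ℝ}
    (hE : ∀ t ∈ Icc t₁ t₂, energy n (u t) ≤ E₀)
    (hρ : ContinuousOn (fun p : ℝ × En n => den u p.1 p.2) (Icc t₁ t₂ ×ˢ univ)) :
    ∫ t in Icc a b, Phi R 0 0 (den u t) ≤ 4 * K * R * (5 * n + 1) * E₀ + (b - a) * (34 * K / R * E₀) := by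
  let sm : ℕ → ℝ := fun m => 1 / ((m : ℝ) + 1)
  have sm0 : ∀ m, 0 < sm m := fun m => by simp only [sm]; positivity
  have sm1 : ∀ m, sm m ≤ 1 := fun m => by
    simp only [sm]; rw [div_le_one (by positivity)]; linarith [(Nat.cast_nonneg m : (0:ℝ) ≤ m)]
  have sml : Tendsto sm atTop (𝓝 0) := tendsto_one_div_add_atTop_nhds_zero_nat
  let em : ℕ → ℝ := fun m => sm m * R ^ 2
  have em0 : ∀ m, 0 < em m := fun m => by have := sm0 m; simp only [em]; positivity
  have eml : Tendsto em atTop (𝓝 0) := by simpa using sml.mul_const (R ^ 2)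
  have hρ' : ContinuousOn (fun p : ℝ × En n => den u p.1 p.2) (Icc a b ×ˢ univ) :=
    hρ.mono (prod_mono (Icc_subset_Icc h1.le h2.le) subset_rfl)
  obtain ⟨p1, p2, p3⟩ := P_limit hn (R := R) hρ' em0 eml
  obtain ⟨q1, q2, q3, -⟩ := Q_limit hn (R := R) hρ' em0 sm0 eml sml
  have hT := p3.add q3
  have e0 : ∫ t in Icc a b, Phi R 0 0 (den u t) = (∫ t in Icc a b, ∫ x, Pd R 0 x * den u t x)
      + ∫ t in Icc a b, ∫ p : En n × En n, Qd R 0 0 p.1 p.2 * (den u t p.1 * den u t p.2) := integral_add p2 q2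
  have em' : ∀ m, ∫ t in Icc a b, Phi R (em m) (sm m) (den u t) = (∫ t in Icc a b, ∫ x, Pd R (em m) x * den u t x)
      + ∫ t in Icc a b, ∫ p : En n × En n, Qd R (em m) (sm m) p.1 p.2 * (den u t p.1 * den u t p.2) :=
    fun m => integral_add (p1 m) (q1 m)
  rw [e0]
  refine le_of_tendsto hT (Eventually.of_forall fun m => ?_)
  rw [← em' m]
  obtain ⟨w₀, hw₀⟩ := hw (sm m) (sm0 m) (sm1 m)
  exact ftc_step hn hK hR (em0 m) (sm0 m) hw₀ h1 hab h2 hu hE ((p1 m).add (q1 m))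

lemma phi_bound (hn : 5 ≤ n) {K R : ℝ} (hK : 0 < K) (hR : 0 < R)
    (hw : ∀ s : ℝ, 0 < s → s ≤ 1 → ∃ w₀ : En n → ℝ, IsWeight n K R (s * R ^ 2) w₀)
    {u : ℝ → En n → ℂ} {t₁ t₂ : ℝ} (h12 : t₁ < t₂) (hu : IsHartreeSolution n (Icc t₁ t₂) u) {E₀ : ℝ}
    (hE0 : 0 ≤ E₀) (hE : ∀ t ∈ Icc t₁ t₂, energy n (u t) ≤ E₀)
    (hρ : ContinuousOn (fun p : ℝ × En n => den u p.1 p.2) (Icc t₁ t₂ ×ˢ univ))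
    (hPhi : IntegrableOn (fun t => Phi R 0 0 (den u t)) (Icc t₁ t₂)) :
    ∫ t in Icc t₁ t₂, Phi R 0 0 (den u t) ≤ 4 * K * R * (5 * n + 1) * E₀ + (t₂ - t₁) * (34 * K / R * E₀) := by
  let δ : ℕ → ℝ := fun m => (t₂ - t₁) / 3 * (1 / ((m : ℝ) + 1))
  have δ0 : ∀ m, 0 < δ m := fun m => by
    simp only [δ]; have : 0 < t₂ - t₁ := by linarith
    positivity
  have δ1 : ∀ m, δ m ≤ (t₂ - t₁) / 3 := fun m => by
    simp only [δ]
    have : 1 / ((m:ℝ) + 1) ≤ 1 := by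
      rw [div_le_one (by positivity)]; linarith [(Nat.cast_nonneg m : (0:ℝ) ≤ m)]
    exact mul_le_of_le_one_right (by linarith) this
  have δl : Tendsto δ atTop (𝓝 0) := by
    have h := (tendsto_one_div_add_atTop_nhds_zero_nat (𝕜 := ℝ)).const_mul ((t₂ - t₁) / 3)
    rw [mul_zero] at h
    exact h
  have la : Tendsto (fun m => t₁ + δ m) atTop (𝓝 t₁) := by simpa using δl.const_add t₁
  have lb : Tendsto (fun m => t₂ - δ m) atTop (𝓝 t₂) := by simpa using δl.const_sub t₂
  have hcov := aecover_Ioo_of_Icc (μ := (volume : Measure ℝ)) la lb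
  have hio : IntegrableOn (fun t => Phi R 0 0 (den u t)) (Ioo t₁ t₂) := hPhi.mono_set Ioo_subset_Icc_self
  have T := hcov.integral_tendsto_of_countably_generated hio
  rw [integral_Icc_eq_integral_Ioo]
  refine le_of_tendsto T (Eventually.of_forall fun m => ?_)
  have hm0 := δ0 m
  have hm1 := δ1 m
  have hs : Icc (t₁ + δ m) (t₂ - δ m) ⊆ Ioo t₁ t₂ := fun t ht => ⟨by linarith [ht.1], by linarith [ht.2]⟩
  rw [Measure.restrict_restrict measurableSet_Icc, inter_eq_self_of_subset_left hs]
  refine (phi_bound_ab hn hK hR hw (by linarith) (by linarith) (by linarith) hu hE hρ).trans ?_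
  have : (t₂ - δ m - (t₁ + δ m)) * (34 * K / R * E₀) ≤ (t₂ - t₁) * (34 * K / R * E₀) :=
    mul_le_mul_of_nonneg_right (by linarith) (by positivity)
  linarith

lemma Qd_zero_inner {R : ℝ} {x y : En n} (hx : ‖x‖ ≤ R) (hy : ‖y‖ ≤ R) :
    ⟪‖x‖⁻¹ • x - ‖y‖⁻¹ • y, (-4 * (‖x - y‖ ^ 6)⁻¹) • (x - y)⟫ = - Qd R 0 0 x y := by
  unfold Qd
  rw [if_pos ⟨hx, hy⟩, Dm_inner, pw_zero, pw_zero]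
  have e0 : ((0:ℝ) ^ 2) = 0 := by norm_num
  rw [e0, pw_zero, real_inner_smul_right, real_inner_comm, inv_pow]
  ring

lemma morawetz_aux (n : ℕ) (hn : 5 ≤ n) :
    ∃ C : ℝ, 0 < C ∧
      ∀ (t₁ t₂ : ℝ), t₁ < t₂ →
      ∀ (u : ℝ → En n → ℂ), IsHartreeSolution n (Set.Icc t₁ t₂) u →
      ∀ (A : ℝ), 1 ≤ A →
      ∀ (E₀ : ℝ), 0 ≤ E₀ →
      (∀ t ∈ Set.Icc t₁ t₂, energy n (u t) ≤ E₀) →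
      (∫ t in Set.Icc t₁ t₂,
          ∫ x in {x : En n | ‖x‖ ≤ A * Real.sqrt (t₂ - t₁)}, ‖u t x‖ ^ 2 / ‖x‖ ^ 3)
      - (∫ t in Set.Icc t₁ t₂,
          ∫ x in {x : En n | ‖x‖ ≤ A * Real.sqrt (t₂ - t₁)},
            ∫ y in {y : En n | ‖y‖ ≤ A * Real.sqrt (t₂ - t₁)},
              ⟪‖x‖⁻¹ • x - ‖y‖⁻¹ • y, (-4 * (‖x - y‖ ^ 6)⁻¹) • (x - y)⟫
                * ‖u t x‖ ^ 2 * ‖u t y‖ ^ 2)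
      ≤ C * A * Real.sqrt (t₂ - t₁) * E₀ := by
  obtain ⟨K, hK, hW⟩ := weight_exists n hn
  refine ⟨K * (4 * (5 * n + 1) + 34), by positivity, ?_⟩
  intro t₁ t₂ h12 u hu A hA E₀ hE0 hE
  set S := Real.sqrt (t₂ - t₁) with hS
  have hS0 : 0 < S := Real.sqrt_pos.2 (by linarith)
  have hS2 : S ^ 2 = t₂ - t₁ := Real.sq_sqrt (by linarith)
  set R := A * S with hRdef
  have hR : 0 < R := by positivity
  have hu0 : ContinuousOn (fun p : ℝ × En n => u p.1 p.2) (Icc t₁ t₂ ×ˢ univ) := hu.smooth.continuousOn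
  have hden : ∀ t x, den u t x = ‖u t x‖ ^ 2 := fun t x => (norm_sq_rho (u t) x).symm
  have hρ : ContinuousOn (fun p : ℝ × En n => den u p.1 p.2) (Icc t₁ t₂ ×ˢ univ) := by
    simp only [hden]
    exact hu0.norm.pow 2
  have sl : Tendsto (fun m : ℕ => 1 / ((m : ℝ) + 1)) atTop (𝓝 0) := tendsto_one_div_add_atTop_nhds_zero_nat
  have s0 : ∀ m : ℕ, 0 < 1 / ((m : ℝ) + 1) := fun m => by positivity
  obtain ⟨-, p2, -⟩ := P_limit hn (R := R) hρ s0 sl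
  obtain ⟨-, q2, -, q4⟩ := Q_limit hn (R := R) hρ s0 s0 sl sl
  have hb := phi_bound hn hK hR (hW R hR) h12 hu hE0 hE hρ (p2.add q2)
  have e0 : ∫ t in Icc t₁ t₂, Phi R 0 0 (den u t) = (∫ t in Icc t₁ t₂, ∫ x, Pd R 0 x * den u t x)
      + ∫ t in Icc t₁ t₂, ∫ p : En n × En n, Qd R 0 0 p.1 p.2 * (den u t p.1 * den u t p.2) := integral_add p2 q2
  rw [e0] at hb
  have hball : {x : En n | ‖x‖ ≤ R} = Metric.closedBall 0 R := by ext x; simp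
  have mB : MeasurableSet (Metric.closedBall (0 : En n) R) := Metric.isClosed_closedBall.measurableSet
  rw [hball]
  -- first term
  have f1 : ∀ t, ∫ x in Metric.closedBall (0 : En n) R, ‖u t x‖ ^ 2 / ‖x‖ ^ 3 = (1/8) * ∫ x, Pd R 0 x * den u t x := by
    intro t
    rw [← integral_const_mul, ← setIntegral_eq_integral_of_forall_compl_eq_zero (s := Metric.closedBall (0 : En n) R)
      (f := fun x => 1 / 8 * (Pd R 0 x * den u t x))]
    · apply setIntegral_congr_fun mB
      intro x hx
      have hx' : ‖x‖ ≤ R := by simpa using hx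
      simp only [Pd, if_pos hx', pw_zero, hden, inv_pow]
      ring
    · intro x hx
      have hx' : ¬ ‖x‖ ≤ R := by simpa using hx
      simp only [Pd, if_neg hx']; ring
  have f1n : 0 ≤ ∫ t in Icc t₁ t₂, ∫ x, Pd R 0 x * den u t x := by
    apply integral_nonneg; intro t
    apply integral_nonneg; intro x
    have : 0 ≤ den u t x := by rw [hden]; positivity
    have h2 : 0 ≤ Pd R 0 x := by
      unfold Pd; split_ifs
      · rw [pw_zero]; positivity
      · exact le_rfl
    exact mul_nonneg h2 this
  -- second term
  have f2 : (∫ t in Set.Icc t₁ t₂, ∫ x in Metric.closedBall (0 : En n) R, ∫ y in Metric.closedBall (0 : En n) R,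
              ⟪‖x‖⁻¹ • x - ‖y‖⁻¹ • y, (-4 * (‖x - y‖ ^ 6)⁻¹) • (x - y)⟫
                * ‖u t x‖ ^ 2 * ‖u t y‖ ^ 2)
      = - ∫ t in Icc t₁ t₂, ∫ p : En n × En n, Qd R 0 0 p.1 p.2 * (den u t p.1 * den u t p.2) := by
    rw [← integral_neg]
    apply integral_congr_ae
    filter_upwards [q4] with t ht
    have g1 : ∫ p : En n × En n, Qd R 0 0 p.1 p.2 * (den u t p.1 * den u t p.2)
        = ∫ p in Metric.closedBall (0 : En n) R ×ˢ Metric.closedBall (0 : En n) R,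
          Qd R 0 0 p.1 p.2 * (den u t p.1 * den u t p.2) := by
      rw [setIntegral_eq_integral_of_forall_compl_eq_zero]
      intro p hp
      have : Qd R 0 0 p.1 p.2 = 0 := by unfold Qd; rw [if_neg]; simpa using hp
      rw [this, zero_mul]
    rw [g1, Measure.volume_eq_prod, setIntegral_prod _ ht, ← integral_neg]
    apply setIntegral_congr_fun mB
    intro x hx
    show _ = - _
    rw [← integral_neg]
    apply setIntegral_congr_fun mB
    intro y hy
    have hx' : ‖x‖ ≤ R := by simpa using hx
    have hy' : ‖y‖ ≤ R := by simpa using hy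
    simp only [Qd_zero_inner hx' hy', hden]
    ring
  rw [f2]
  simp only [f1]
  rw [integral_const_mul]
  have hfin : 4 * K * R * (5 * n + 1) * E₀ + (t₂ - t₁) * (34 * K / R * E₀) ≤ K * (4 * (5 * n + 1) + 34) * A * S * E₀ := by
    have hq : (t₂ - t₁) * (34 * K / R * E₀) ≤ 34 * K * (A * S) * E₀ := by
      rw [← hS2, hRdef]
      have : S ^ 2 * (34 * K / (A * S) * E₀) = 34 * K * E₀ * S * A⁻¹ := by
        field_simp
      rw [this]
      have hA1 : A⁻¹ ≤ A := (inv_le_one_of_one_le₀ hA).trans hA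
      have : 34 * K * E₀ * S * A⁻¹ ≤ 34 * K * E₀ * S * A := mul_le_mul_of_nonneg_left hA1 (by positivity)
      linarith
    rw [hRdef] at hq ⊢
    linarith
  linarith

end Final

/-- Morawetz estimate: the localized Morawetz quantity is bounded by `C·A·|I|^{1/2}·E₀`,
with `C` depending only on the dimension `n`. Here `∇V(z) = -4‖z‖⁻⁶ z`. -/
theorem morawetz_estimate (n : ℕ) (hn : 5 ≤ n) :
    ∃ C : ℝ, 0 < C ∧
      ∀ (t₁ t₂ : ℝ), t₁ < t₂ →
      ∀ (u : ℝ → En n → ℂ), IsHartreeSolution n (Set.Icc t₁ t₂) u →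
      ∀ (A : ℝ), 1 ≤ A →
      ∀ (E₀ : ℝ), 0 ≤ E₀ →
      (∀ t ∈ Set.Icc t₁ t₂, energy n (u t) ≤ E₀) →
      (∫ t in Set.Icc t₁ t₂,
          ∫ x in {x : En n | ‖x‖ ≤ A * Real.sqrt (t₂ - t₁)}, ‖u t x‖ ^ 2 / ‖x‖ ^ 3)
      - (∫ t in Set.Icc t₁ t₂,
          ∫ x in {x : En n | ‖x‖ ≤ A * Real.sqrt (t₂ - t₁)},
            ∫ y in {y : En n | ‖y‖ ≤ A * Real.sqrt (t₂ - t₁)},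
              ⟪‖x‖⁻¹ • x - ‖y‖⁻¹ • y, (-4 * (‖x - y‖ ^ 6)⁻¹) • (x - y)⟫
                * ‖u t x‖ ^ 2 * ‖u t y‖ ^ 2)
      ≤ C * A * Real.sqrt (t₂ - t₁) * E₀ := by
  exact morawetz_aux n hn

end
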